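/- arXiv:2312.11185 — 2 statements merged into one kernel-verified Lean document; each statement's English description precedes it below -/
import Mathlib

section
/- Let E = A − iB be an entire function of Hermite–Biehler class such that A/B ∈ AP(ℍ) and λ ↦ ℰ(iA/B)(λ) is locally summable. Define a(λ) = ℰ(iA/B)(λ) for λ > 0, a(0) = 2·Re ℰ(iA/B)(0), a(−λ) = conj(a(λ)) for λ > 0, and μ = 2π Σ_{γ : φ_E(γ) ≡ 0 (mod π)} (1/φ_E'(γ)) δ_γ. Then (μ,a) is a real-antipodal FS-pair, μ ≥ 0, and μ has locally finite support (its support intersects every bounded interval in a finite set). -/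
open MeasureTheory Complex Filter Topology Set
open scoped ENNReal

noncomputable section

/-- The open upper half-plane, as a subset of `ℂ`. -/
def UHP : Set ℂ := {z : ℂ | 0 < z.im}

/-- A relatively dense subset of `ℝ`. -/
def RelDense (τ : Set ℝ) : Prop := ∃ l > (0:ℝ), ∀ x : ℝ, ∃ t ∈ τ, x < t ∧ t < x + l

/-- Bohr almost periodic continuous functions on `ℝ`. -/
def APR (f : ℝ → ℂ) : Prop :=
  Continuous f ∧ ∀ ε > (0:ℝ), RelDense {t : ℝ | ∀ x : ℝ, ‖f x - f (x + t)‖ ≤ ε}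

/-- Holomorphic almost periodic functions on the upper half-plane. -/
def APH (f : ℂ → ℂ) : Prop :=
  DifferentiableOn ℂ f UHP ∧
  ∀ α β ε : ℝ, 0 < α → α < β → 0 < ε →
    ∃ τ : Set ℝ, RelDense τ ∧
      ∀ t ∈ τ, ∀ z : ℂ, α < z.im → z.im < β → ‖f z - f (z + (t : ℂ))‖ ≤ ε

/-- `HasMeanAt f y lam c` : the mean `(1/2T)∫_{-T+iy}^{T+iy} f(z) e^{-2πiλz} dz` tends to `c`. -/
def HasMeanAt (f : ℂ → ℂ) (y lam : ℝ) (c : ℂ) : Prop :=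
  Tendsto (fun T : ℝ => (1 / (2 * (T : ℂ))) *
      ∫ x in (-T)..T, f ((x : ℂ) + (y : ℂ) * Complex.I) *
        Complex.exp (-(2 * (Real.pi : ℂ) * Complex.I * (lam : ℂ) * ((x : ℂ) + (y : ℂ) * Complex.I))))
    atTop (𝓝 c)

/-- `HasMeanR f lam c` : the Bohr mean `(1/2T)∫_{-T}^{T} f(x) e^{-2πiλx} dx` tends to `c`. -/
def HasMeanR (f : ℝ → ℂ) (lam : ℝ) (c : ℂ) : Prop :=
  Tendsto (fun T : ℝ => (1 / (2 * (T : ℂ))) *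
      ∫ x in (-T)..T, f x *
        Complex.exp (-(2 * (Real.pi : ℂ) * Complex.I * (lam : ℂ) * (x : ℂ))))
    atTop (𝓝 c)

/-- The spectrum of a function on the upper half-plane: frequencies where the mean is not `0`. -/
def specH (f : ℂ → ℂ) : Set ℝ := {lam : ℝ | ∃ y > (0:ℝ), ¬ HasMeanAt f y lam 0}

/-- A locally finite subset of `ℝ`. -/
def LocFinSet (S : Set ℝ) : Prop := ∀ a b : ℝ, (S ∩ Set.Ioo a b).Finite

/-- A uniformly discrete subset of `ℝ`. -/
def UnifDiscrete (S : Set ℝ) : Prop :=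
  ∃ d > (0:ℝ), ∀ x ∈ S, ∀ y ∈ S, x ≠ y → d ≤ |x - y|

/-- Locally summable coefficient functions. -/
def LocSummable (a : ℝ → ℂ) : Prop :=
  (Function.support a).Countable ∧
  ∀ T > (0:ℝ), Summable (Set.indicator (Set.Icc (-T) T) fun l => ‖a l‖)

/-- Exponential growth of a coefficient function. -/
def ExpGrowth (a : ℝ → ℂ) : Prop :=
  ∃ c > (0:ℝ), Summable fun lam : ℝ => ‖a lam‖ * Real.exp (-c * |lam|)

/-- `a(-λ) = conj (a(λ))`. -/
def Antipodal (a : ℝ → ℂ) : Prop := ∀ lam : ℝ, a (-lam) = (starRingEnd ℂ) (a lam)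

/-- The Fourier transform `φ̂(ξ) = ∫ φ(x) e^{-2πixξ} dx`. -/
def FT (φ : ℝ → ℂ) (ξ : ℝ) : ℂ :=
  ∫ x : ℝ, φ x * Complex.exp (-(2 * (Real.pi : ℂ) * Complex.I * (x : ℂ) * (ξ : ℂ)))

/-- A complex-valued measure on `ℝ`, encoded by its total variation `ν` together with a
unimodular density `w`, so that `dμ = w dν` and `|μ| = ν`. -/
structure CMeasure where
  ν : Measure ℝ
  w : ℝ → ℂ
  meas : Measurable w
  unit : ∀ᵐ t ∂ν, ‖w t‖ = 1

/-- Integration against a complex measure. -/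
def CMeasure.integral (μ : CMeasure) (φ : ℝ → ℂ) : ℂ := ∫ t, φ t * μ.w t ∂μ.ν

/-- Strongly tempered: every Schwartz function is `|μ|`-integrable. -/
def CMeasure.IsStronglyTempered (μ : CMeasure) : Prop :=
  ∀ φ : SchwartzMap ℝ ℂ, Integrable (fun t => φ t) μ.ν

/-- Real-valued complex measure. -/
def CMeasure.RealValued (μ : CMeasure) : Prop := ∀ᵐ t ∂μ.ν, (μ.w t).im = 0

/-- Nonnegative complex measure. -/
def CMeasure.Nonneg (μ : CMeasure) : Prop := ∀ᵐ t ∂μ.ν, μ.w t = 1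

/-- `deg(μ) ≤ n` : `∫ (1+t²)^{-n/2} d|μ| < ∞`. -/
def CMeasure.DegLE (μ : CMeasure) (n : ℕ) : Prop :=
  Integrable (fun t : ℝ => (1 + t ^ 2) ^ (-(n : ℝ) / 2)) μ.ν

/-- The mass `μ({x})` of an atom. -/
def CMeasure.atom (μ : CMeasure) (x : ℝ) : ℂ := ∫ t in {x}, μ.w t ∂μ.ν

/-- The (closed) support of a measure on `ℝ`. -/
def measSupport (ν : Measure ℝ) : Set ℝ := {x : ℝ | ∀ U ∈ 𝓝 x, ν U ≠ 0}

/-- `(μ, a)` is a Fourier summation pair. -/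
def IsFSPair (μ : CMeasure) (a : ℝ → ℂ) : Prop :=
  μ.IsStronglyTempered ∧ LocSummable a ∧
    ∀ φ : ℝ → ℂ, ContDiff ℝ (⊤ : ℕ∞) φ → HasCompactSupport φ →
      μ.integral (FT φ) = ∑' lam : ℝ, a lam * φ lam

/-- Trigonometric polynomials. -/
def IsTrigPoly (f : ℂ → ℂ) : Prop :=
  ∃ (N : ℕ) (p : Fin N → ℂ) (θ : Fin N → ℝ),
    ∀ z : ℂ, f z = ∑ n, p n * Complex.exp (2 * (Real.pi : ℂ) * Complex.I * (θ n : ℂ) * z)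

/-- Functions of bounded type on the upper half-plane. -/
def BoundedType (g : ℂ → ℂ) : Prop :=
  ∃ P Q : ℂ → ℂ, DifferentiableOn ℂ P UHP ∧ DifferentiableOn ℂ Q UHP ∧
    (∃ C : ℝ, ∀ z ∈ UHP, ‖P z‖ ≤ C) ∧ (∃ C : ℝ, ∀ z ∈ UHP, ‖Q z‖ ≤ C) ∧
    (∀ z ∈ UHP, Q z ≠ 0) ∧ ∀ z ∈ UHP, g z = P z / Q z

/-- Mean type `ϑ(g) = limsup_{y→∞} log|g(iy)|/y`. -/
def MeanType (g : ℂ → ℂ) : ℝ :=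
  Filter.limsup (fun y : ℝ => Real.log ‖g ((y : ℂ) * Complex.I)‖ / y) atTop

/-- `E*(z) = conj (E (conj z))`. -/
def fstar (E : ℂ → ℂ) : ℂ → ℂ := fun z => (starRingEnd ℂ) (E ((starRingEnd ℂ) z))

/-- Hermite–Biehler class: entire with `|E*(z)| < |E(z)|` on the upper half-plane. -/
def HB (E : ℂ → ℂ) : Prop := Differentiable ℂ E ∧ ∀ z ∈ UHP, ‖fstar E z‖ < ‖E z‖

/-- `A = (E* + E)/2`. -/
def HBA (E : ℂ → ℂ) : ℂ → ℂ := fun z => (fstar E z + E z) / 2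

/-- `B = (E* - E)/(2i)`. -/
def HBB (E : ℂ → ℂ) : ℂ → ℂ := fun z => (fstar E z - E z) / (2 * Complex.I)

/-- `φ` is a phase function for `E`, with derivative `φd > 0`. -/
def IsPhaseFor (φ φd : ℝ → ℝ) (E : ℂ → ℂ) : Prop :=
  (∀ x : ℝ, HasDerivAt φ (φd x) x) ∧ (∀ x : ℝ, 0 < φd x) ∧
    ∀ x : ℝ, (Complex.exp (Complex.I * (φ x : ℂ)) * E (x : ℂ)).im = 0

/-- The points where `φ ≡ 0 (mod π)`. -/
def phaseZeros (φ : ℝ → ℝ) : Set ℝ := {γ : ℝ | ∃ k : ℤ, φ γ = k * Real.pi}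

/-- The nonnegative measure `2π Σ_{φ(γ)≡0 (mod π)} (1/φ'(γ)) δ_γ`. -/
def phaseMeasure (φ φd : ℝ → ℝ) : Measure ℝ :=
  Measure.sum fun γ : phaseZeros φ =>
    (ENNReal.ofReal (2 * Real.pi / φd (γ : ℝ))) • Measure.dirac (γ : ℝ)

/-- `μ` is an `ℕ`-valued nonnegative measure. -/
def CMeasure.NValued (μ : CMeasure) : Prop :=
  μ.Nonneg ∧ ∃ (Λ : Set ℝ) (m : ℝ → ℕ), LocFinSet Λ ∧ (∀ γ ∈ Λ, 0 < m γ) ∧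
    μ.ν = Measure.sum fun γ : Λ => (m (γ : ℝ) : ℝ≥0∞) • Measure.dirac (γ : ℝ)

/-- Bounded on every horizontal substrip of the upper half-plane. -/
def BddOnStrips (f : ℂ → ℂ) : Prop :=
  ∀ ε > (0:ℝ), ∃ C : ℝ, ∀ z : ℂ, ε < z.im → z.im < 1/ε → ‖f z‖ ≤ C

/-- The Fejér-type partial sums in formula (eq:fdef). -/
def fdefSum (a : ℝ → ℂ) (T : ℝ) (z : ℂ) : ℂ :=
  a 0 / 2 + ∑' lam : ℝ,
    Set.indicator (Set.Ioo (0 : ℝ) T)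
      (fun l => a l * (1 - (l : ℂ) / (T : ℂ)) *
        Complex.exp (2 * (Real.pi : ℂ) * Complex.I * (l : ℂ) * z)) lam

/-- The character `x ↦ e^{2πiξx}` of the real line. -/
def realChar (ξ x : ℝ) : ℂ := cexp ((2 * Real.pi * ξ * x : ℝ) * I)

lemma norm_realChar (ξ x : ℝ) : ‖realChar ξ x‖ = 1 := norm_exp_ofReal_mul_I _

lemma realChar_add (ξ x y : ℝ) : realChar ξ (x + y) = realChar ξ x * realChar ξ y := by
  simp only [realChar, ← Complex.exp_add]
  congr 1; push_cast; ring

lemma realChar_add_left (ξ η x : ℝ) : realChar (ξ + η) x = realChar ξ x * realChar η x := by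
  simp only [realChar, ← Complex.exp_add]
  congr 1; push_cast; ring

lemma realChar_comm (ξ x : ℝ) : realChar ξ x = realChar x ξ := by
  simp only [realChar]; congr 3; ring

@[simp] lemma realChar_zero_left (x : ℝ) : realChar 0 x = 1 := by simp [realChar]

@[simp] lemma realChar_zero_right (ξ : ℝ) : realChar ξ 0 = 1 := by simp [realChar]

lemma continuous_realChar (ξ : ℝ) : Continuous (realChar ξ) := by
  unfold realChar; fun_prop

lemma continuous_realChar_left (x : ℝ) : Continuous fun ξ => realChar ξ x := by
  unfold realChar; fun_prop

lemma realChar_neg_left (ξ x : ℝ) : realChar (-ξ) x = (starRingEnd ℂ) (realChar ξ x) := by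
  simp only [realChar, ← Complex.exp_conj]
  rw [map_mul, conj_ofReal, conj_I]
  congr 1; push_cast; ring

lemma realChar_neg_right (ξ x : ℝ) : realChar ξ (-x) = (starRingEnd ℂ) (realChar ξ x) := by
  rw [realChar_comm, realChar_neg_left, realChar_comm]

lemma exp_neg_eq_realChar (ξ x : ℝ) :
    cexp (-(2 * (Real.pi : ℂ) * I * (ξ : ℂ) * (x : ℂ))) = realChar (-ξ) x := by
  simp only [realChar]; congr 1; push_cast; ring

lemma norm_realChar_sub_le (ξ η x : ℝ) :
    ‖realChar ξ x - realChar η x‖ ≤ 2 * Real.pi * |ξ - η| * |x| := by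
  have h : realChar ξ x - realChar η x = realChar η x * (realChar (ξ - η) x - 1) := by
    rw [mul_sub, ← realChar_add_left]; simp
  rw [h, norm_mul, norm_realChar, one_mul]
  have := Real.norm_exp_I_mul_ofReal_sub_one_le (x := 2 * Real.pi * (ξ - η) * x)
  rw [mul_comm I] at this
  refine this.trans (le_of_eq ?_)
  simp [abs_of_pos Real.pi_pos]

/-- Bohr almost periodic functions on the line, described by precompactness of the set of
translates in the uniform norm. -/
structure BohrAP (k : ℝ → ℂ) : Prop where
  unif : ∀ ε > (0 : ℝ), ∃ δ > (0 : ℝ), ∀ h, |h| ≤ δ → ∀ x, ‖k (x + h) - k x‖ ≤ ε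
  bdd : ∃ C, ∀ x, ‖k x‖ ≤ C
  net : ∀ ε > (0 : ℝ), ∃ F : Finset ℝ, ∀ s, ∃ s' ∈ F, ∀ x, ‖k (x + s) - k (x + s')‖ ≤ ε

lemma BohrAP.continuous {k : ℝ → ℂ} (hk : BohrAP k) : Continuous k := by
  rw [Metric.continuous_iff]
  intro b ε hε
  obtain ⟨δ, hδ, h⟩ := hk.unif (ε / 2) (by positivity)
  refine ⟨δ, hδ, fun a hab => ?_⟩
  have := h (a - b) (by rw [← Real.dist_eq]; exact hab.le) b
  rw [add_sub_cancel] at this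
  rw [dist_eq_norm]; linarith

/-- The Fourier integral of a translate of `k` over the window `[-T, T]`. -/
def windowFourier (k : ℝ → ℂ) (T s ξ : ℝ) : ℂ := ∫ x in (-T)..T, k (x + s) * realChar ξ x

lemma norm_integral_shift_sub_le {F : ℝ → ℂ} (hF : Continuous F) {C : ℝ} (hC : ∀ x, ‖F x‖ ≤ C)
    (a b h : ℝ) : ‖(∫ x in (a + h)..(b + h), F x) - ∫ x in a..b, F x‖ ≤ 2 * C * |h| := by
  have i : ∀ u v, IntervalIntegrable F volume u v := fun u v => hF.intervalIntegrable u v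
  rw [intervalIntegral.integral_interval_sub_interval_comm (i _ _) (i _ _) (i _ _)]
  have h1 := intervalIntegral.norm_integral_le_of_norm_le_const (a := a + h) (b := a)
    (f := F) (C := C) (fun x _ => hC x)
  have h2 := intervalIntegral.norm_integral_le_of_norm_le_const (a := b + h) (b := b)
    (f := F) (C := C) (fun x _ => hC x)
  refine (norm_sub_le _ _).trans ?_
  have e1 : |a - (a + h)| = |h| := by rw [show a - (a + h) = -h by ring, abs_neg]
  have e2 : |b - (b + h)| = |h| := by rw [show b - (b + h) = -h by ring, abs_neg]
  rw [e1] at h1; rw [e2] at h2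
  linarith

lemma windowFourier_double {k : ℝ → ℂ} (hk : Continuous k) (T s ξ : ℝ) :
    ‖windowFourier k (2 * T) s ξ‖ ≤
      ‖windowFourier k T (s - T) ξ‖ + ‖windowFourier k T (s + T) ξ‖ := by
  have hc : Continuous fun x => k (x + s) * realChar ξ x :=
    (hk.comp (continuous_id.add continuous_const)).mul (continuous_realChar ξ)
  have e1 : (∫ x in (-(2 * T))..0, k (x + s) * realChar ξ x) =
      realChar ξ (-T) * windowFourier k T (s - T) ξ := by
    have := intervalIntegral.integral_comp_add_right (a := -T) (b := T)
      (fun x => k (x + s) * realChar ξ x) (-T)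
    rw [show -T + -T = -(2 * T) by ring, show T + -T = 0 by ring] at this
    rw [← this, windowFourier, ← intervalIntegral.integral_const_mul]
    congr 1; ext x
    rw [realChar_add, show x + -T + s = x + (s - T) by ring]; ring
  have e2 : (∫ x in 0..(2 * T), k (x + s) * realChar ξ x) =
      realChar ξ T * windowFourier k T (s + T) ξ := by
    have := intervalIntegral.integral_comp_add_right (a := -T) (b := T)
      (fun x => k (x + s) * realChar ξ x) T
    rw [show T + T = (2 * T) by ring, show -T + T = 0 by ring] at this
    rw [← this, windowFourier, ← intervalIntegral.integral_const_mul]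
    congr 1; ext x
    rw [realChar_add, show x + T + s = x + (s + T) by ring]; ring
  rw [windowFourier, ← intervalIntegral.integral_add_adjacent_intervals
    (hc.intervalIntegrable _ 0) (hc.intervalIntegrable 0 _), e1, e2]
  refine (norm_add_le _ _).trans (le_of_eq ?_)
  simp [norm_realChar]

lemma norm_windowFourier_sub_le {k : ℝ → ℂ} {T ε s s' : ℝ} (hk : Continuous k) (hT : 0 ≤ T)
    (h : ∀ x, ‖k (x + s) - k (x + s')‖ ≤ ε) (ξ : ℝ) :
    ‖windowFourier k T s ξ - windowFourier k T s' ξ‖ ≤ 2 * ε * T := by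
  have hc : ∀ s, Continuous fun x => k (x + s) * realChar ξ x := fun s =>
    (hk.comp (continuous_id.add continuous_const)).mul (continuous_realChar ξ)
  rw [windowFourier, windowFourier, ← intervalIntegral.integral_sub
    ((hc s).intervalIntegrable _ _) ((hc s').intervalIntegrable _ _)]
  refine (intervalIntegral.norm_integral_le_of_norm_le_const (C := ε) fun x _ => ?_).trans ?_
  · rw [← sub_mul, norm_mul, norm_realChar, mul_one]; exact h x
  · rw [abs_of_nonneg (by linarith)]; linarith

lemma norm_windowFourier_sub_freq_le {k : ℝ → ℂ} {T C : ℝ} (hk : Continuous k) (hT : 0 ≤ T)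
    (hC : ∀ x, ‖k x‖ ≤ C) (s ξ η : ℝ) :
    ‖windowFourier k T s ξ - windowFourier k T s η‖ ≤
      C * (2 * Real.pi * |ξ - η| * T) * (2 * T) := by
  have hC0 : 0 ≤ C := (norm_nonneg _).trans (hC 0)
  have hc : ∀ ξ, Continuous fun x => k (x + s) * realChar ξ x := fun ξ =>
    (hk.comp (continuous_id.add continuous_const)).mul (continuous_realChar ξ)
  rw [windowFourier, windowFourier, ← intervalIntegral.integral_sub
    ((hc ξ).intervalIntegrable _ _) ((hc η).intervalIntegrable _ _)]
  refine (intervalIntegral.norm_integral_le_of_norm_le_const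
    (C := C * (2 * Real.pi * |ξ - η| * T)) fun x hx => ?_).trans ?_
  · rw [uIoc_of_le (by linarith)] at hx
    rw [← mul_sub, norm_mul]
    refine mul_le_mul (hC _) ((norm_realChar_sub_le _ _ _).trans ?_) (norm_nonneg _) hC0
    have : |x| ≤ T := abs_le.2 ⟨hx.1.le, hx.2⟩
    have := Real.pi_pos
    gcongr
  · rw [abs_of_nonneg (a := T - -T) (by linarith)]; apply le_of_eq; ring

lemma norm_windowFourier_sub_zero_le {k : ℝ → ℂ} {C : ℝ} (hk : Continuous k)
    (hC : ∀ x, ‖k x‖ ≤ C) (T s ξ : ℝ) :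
    ‖windowFourier k T s ξ‖ ≤ ‖windowFourier k T 0 ξ‖ + 2 * C * |s| := by
  have hc : Continuous fun x => k x * realChar ξ x := hk.mul (continuous_realChar ξ)
  have e : windowFourier k T s ξ =
      realChar ξ (-s) * ∫ x in (-T + s)..(T + s), k x * realChar ξ x := by
    rw [← intervalIntegral.integral_comp_add_right (fun x => k x * realChar ξ x) s,
      windowFourier, ← intervalIntegral.integral_const_mul]
    congr 1; ext x
    rw [mul_left_comm, ← realChar_add]; congr 2; ring
  have := norm_integral_shift_sub_le hc (C := C)
    (fun x => by rw [norm_mul, norm_realChar, mul_one]; exact hC x) (-T) T s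
  rw [e, norm_mul, norm_realChar, one_mul]
  have e0 : windowFourier k T 0 ξ = ∫ x in (-T)..T, k x * realChar ξ x := by
    simp [windowFourier]
  rw [e0]
  have := norm_le_norm_add_norm_sub' (∫ x in (-T + s)..(T + s), k x * realChar ξ x)
    (∫ x in (-T)..T, k x * realChar ξ x)
  linarith

lemma BohrAP.eventually_windowFourier_le {k : ℝ → ℂ} (hk : BohrAP k) {ξ : ℝ}
    (h0 : HasMeanR k (-ξ) 0) {ε : ℝ} (hε : 0 < ε) :
    ∀ᶠ T in atTop, ∀ s, ‖windowFourier k T s ξ‖ ≤ ε * T := by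
  obtain ⟨F, hF⟩ := hk.net (ε / 8) (by positivity)
  obtain ⟨C, hC⟩ := hk.bdd
  have hC0 : 0 ≤ C := (norm_nonneg _).trans (hC 0)
  obtain ⟨M, hM⟩ : ∃ M, ∀ s ∈ F, |s| ≤ M := by
    obtain ⟨M, hM⟩ := (F.image fun s => |s|).bddAbove
    exact ⟨M, fun s hs => hM (by simpa using ⟨s, hs, rfl⟩)⟩
  have h1 : ∀ᶠ T : ℝ in atTop, 2 * C * M ≤ ε / 4 * T :=
    (tendsto_id.const_mul_atTop (by positivity : 0 < ε / 4)).eventually_ge_atTop _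
  have h2 := (tendsto_zero_iff_norm_tendsto_zero.1 h0).eventually
    (gt_mem_nhds (show (0 : ℝ) < ε / 8 by positivity))
  filter_upwards [h1, h2, eventually_gt_atTop 0] with T h1 h2 hT s
  obtain ⟨s', hs', h⟩ := hF s
  have a1 := norm_windowFourier_sub_le hk.continuous hT.le h ξ
  have a2 := norm_windowFourier_sub_zero_le hk.continuous hC T s' ξ
  have a3 : ‖windowFourier k T 0 ξ‖ ≤ ε / 4 * T := by
    simp only [exp_neg_eq_realChar, neg_neg] at h2
    rw [norm_mul] at h2
    have e : ‖(1 / (2 * (T : ℂ)))‖ = 1 / (2 * T) := by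
      simp [abs_of_pos hT]
    rw [e] at h2
    simp only [windowFourier, add_zero]
    rw [one_div, inv_mul_lt_iff₀ (by positivity)] at h2
    linarith
  have a4 : 2 * C * |s'| ≤ 2 * C * M := by have := hM s' hs'; gcongr
  have a5 := norm_le_norm_add_norm_sub' (windowFourier k T s ξ) (windowFourier k T s' ξ)
  have := mul_pos hε hT
  linarith

lemma BohrAP.exists_windowFourier_le_of_large {k : ℝ → ℂ} (hk : BohrAP k) {ε q : ℝ}
    (hε : 0 < ε) (hq : 0 < q) :
    ∃ R > (0 : ℝ), ∀ ξ, R ≤ |ξ| → ∀ T ≥ q, ∀ s, ‖windowFourier k T s ξ‖ ≤ ε * T := by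
  obtain ⟨δ, hδ, hu⟩ := hk.unif (ε / 2) (by positivity)
  obtain ⟨C, hC⟩ := hk.bdd
  have hC0 : 0 ≤ C := (norm_nonneg _).trans (hC 0)
  have hη : 0 < min δ (ε * q / (2 * (C + 1))) := by positivity
  refine ⟨1 / (2 * min δ (ε * q / (2 * (C + 1)))), by positivity, fun ξ hξ T hT s => ?_⟩
  have hξ0 : 0 < |ξ| := lt_of_lt_of_le (by positivity) hξ
  have hξ1 : ξ ≠ 0 := abs_pos.1 hξ0
  set h : ℝ := 1 / (2 * ξ) with hh
  have hab : |h| ≤ min δ (ε * q / (2 * (C + 1))) := by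
    rw [hh, abs_div, abs_mul, abs_one, abs_two, div_le_iff₀ (by positivity)]
    rw [div_le_iff₀ (by positivity)] at hξ
    linarith
  have hab1 : |h| ≤ δ := hab.trans (min_le_left _ _)
  have hab2 : C * |h| ≤ ε / 2 * T := by
    have := hab.trans (min_le_right _ _)
    rw [le_div_iff₀ (by positivity)] at this
    have h3 : ε * q ≤ ε * T := by gcongr
    nlinarith [abs_nonneg h]
  have hch : realChar ξ h = -1 := by
    rw [realChar, hh]
    have : 2 * Real.pi * ξ * (1 / (2 * ξ)) = Real.pi := by field_simp
    rw [this, exp_pi_mul_I]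
  have hc : Continuous fun x => k (x + s) * realChar ξ x :=
    (hk.continuous.comp (continuous_id.add continuous_const)).mul (continuous_realChar ξ)
  have hsh := norm_integral_shift_sub_le hc (C := C)
    (fun x => by rw [norm_mul, norm_realChar, mul_one]; exact hC _) (-T) T h
  have e : (∫ x in (-T + h)..(T + h), k (x + s) * realChar ξ x) =
      -windowFourier k T (s + h) ξ := by
    rw [← intervalIntegral.integral_comp_add_right (fun x => k (x + s) * realChar ξ x) h,
      windowFourier, ← intervalIntegral.integral_neg]
    congr 1; ext x
    rw [realChar_add, hch, show x + h + s = x + (s + h) by ring]; ring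
  have e' : windowFourier k T s ξ = ∫ x in (-T)..T, k (x + s) * realChar ξ x := rfl
  rw [e, ← e'] at hsh
  have a1 := norm_windowFourier_sub_le (T := T) (s := s + h) (s' := s) (ε := ε / 2)
    hk.continuous (by linarith) (fun x => by
      rw [← add_assoc, add_right_comm x s h]
      have := hu h hab1 (x + s)
      rwa [add_right_comm] at this) ξ
  have a2 : ‖windowFourier k T s ξ + windowFourier k T s ξ‖ ≤ 2 * C * |h| + 2 * (ε / 2) * T := by
    have : windowFourier k T s ξ + windowFourier k T s ξ =
      -((-windowFourier k T (s + h) ξ - windowFourier k T s ξ) +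
        (windowFourier k T (s + h) ξ - windowFourier k T s ξ)) := by ring
    rw [this, norm_neg]
    exact (norm_add_le _ _).trans (add_le_add hsh a1)
  rw [← two_mul, norm_mul, Complex.norm_two] at a2
  linarith

lemma BohrAP.exists_windowFourier_le {k : ℝ → ℂ} (hk : BohrAP k)
    (h0 : ∀ ξ, HasMeanR k ξ 0) {ε q : ℝ} (hε : 0 < ε) (hq : 0 < q) :
    ∃ n : ℕ, ∀ ξ s, ‖windowFourier k (2 ^ n * q) s ξ‖ ≤ ε * (2 ^ n * q) := by
  obtain ⟨R, hR, hl⟩ := hk.exists_windowFourier_le_of_large hε hq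
  obtain ⟨C, hC⟩ := hk.bdd
  have hC0 : 0 ≤ C := (norm_nonneg _).trans (hC 0)
  have hlim : Tendsto (fun n : ℕ => 2 ^ n * q) atTop atTop :=
    (tendsto_pow_atTop_atTop_of_one_lt (by norm_num : (1 : ℝ) < 2)).atTop_mul_const hq
  have step : ∀ ξ (n : ℕ), (∀ s, ‖windowFourier k (2 ^ n * q) s ξ‖ ≤ ε * (2 ^ n * q)) →
      ∀ s, ‖windowFourier k (2 ^ (n + 1) * q) s ξ‖ ≤ ε * (2 ^ (n + 1) * q) := by
    intro ξ n h s
    have := windowFourier_double hk.continuous (2 ^ n * q) s ξ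
    rw [← mul_assoc, ← pow_succ'] at this
    have h1 := h (s - 2 ^ n * q)
    have h2 := h (s + 2 ^ n * q)
    rw [pow_succ] at this ⊢
    linarith
  have key : ∀ ξ ∈ Icc (-R) R, {p : ℕ × ℝ | ∀ s, ‖windowFourier k (2 ^ p.1 * q) s p.2‖ ≤
      ε * (2 ^ p.1 * q)} ∈ atTop ×ˢ 𝓝 ξ := by
    intro ξ _
    have hn := hlim.eventually (hk.eventually_windowFourier_le (ξ := ξ) (h0 _)
      (show 0 < ε / 2 by positivity))
    obtain ⟨n, hn⟩ := hn.exists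
    set T : ℝ := 2 ^ n * q with hT
    have hTpos : 0 < T := by positivity
    have hcont : ∀ᶠ η in 𝓝 ξ, C * (2 * Real.pi * |ξ - η| * T) * (2 * T) < ε / 2 * T := by
      have : Tendsto (fun η => C * (2 * Real.pi * |ξ - η| * T) * (2 * T)) (𝓝 ξ)
          (𝓝 (C * (2 * Real.pi * |ξ - ξ| * T) * (2 * T))) :=
        (Continuous.tendsto (by fun_prop) ξ)
      simp only [sub_self, abs_zero, mul_zero, zero_mul] at this
      exact this.eventually (gt_mem_nhds (by positivity))
    rw [mem_prod_iff]
    refine ⟨Ici n, Ici_mem_atTop n, _, hcont, ?_⟩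
    rintro ⟨N, η⟩ ⟨hN, hη⟩
    simp only [mem_Ici, mem_ofPred_eq] at hN hη ⊢
    induction N, hN using Nat.le_induction with
    | base =>
      intro s
      have a1 := norm_windowFourier_sub_freq_le hk.continuous hTpos.le hC s ξ η
      have a2 := hn s
      have a3 := norm_le_norm_add_norm_sub (windowFourier k T s ξ) (windowFourier k T s η)
      rw [← hT]; linarith
    | succ N _ ih => exact step η N ih
  have := isCompact_Icc.mem_prod_nhdsSet_of_forall key
  rw [mem_prod_iff] at this
  obtain ⟨A, hA, B, hB, hAB⟩ := this
  obtain ⟨n, hn⟩ := (show ∀ᶠ n in atTop, n ∈ A from hA).exists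
  refine ⟨n, fun ξ => ?_⟩
  by_cases hξ : ξ ∈ Icc (-R) R
  · have h := hAB (mk_mem_prod hn (subset_of_mem_nhdsSet hB hξ))
    simp only [mem_ofPred_eq] at h
    exact h
  · refine hl ξ ?_ _ ?_
    · by_contra! h
      exact hξ ⟨(abs_lt.1 h).1.le, (abs_lt.1 h).2.le⟩
    · have : (1 : ℝ) ≤ 2 ^ n := one_le_pow₀ (by norm_num)
      nlinarith

open scoped FourierTransform SchwartzMap in
lemma fourier_eq_integral_realChar (f : ℝ → ℂ) (ξ : ℝ) :
    𝓕 f ξ = ∫ x, f x * realChar (-ξ) x := by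
  rw [Real.fourier_real_eq_integral_exp_smul]
  congr 1; ext x
  rw [smul_eq_mul, mul_comm, realChar]
  congr 3; push_cast; ring

open scoped FourierTransform SchwartzMap in
lemma fourierInv_eq_integral_realChar (f : ℝ → ℂ) (x : ℝ) :
    𝓕⁻ f x = ∫ ξ, f ξ * realChar x ξ := by
  rw [Real.fourierInv_eq', ]
  congr 1; ext ξ
  rw [smul_eq_mul, mul_comm, realChar]
  congr 3; simp; ring

open scoped FourierTransform SchwartzMap ComplexConjugate in
lemma exists_positive_definite_bump {δ : ℝ} (hδ : 0 < δ) :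
    ∃ (Δ D : ℝ → ℝ), Continuous Δ ∧ (∀ t, 0 ≤ Δ t) ∧ (∀ t, δ ≤ |t| → Δ t = 0) ∧
      0 < ∫ t, Δ t ∧ (∀ ξ, 0 ≤ D ξ) ∧ Integrable D ∧
      ∀ t, (Δ t : ℂ) = ∫ ξ, (D ξ : ℂ) * realChar ξ t := by
  let β : ContDiffBump (0 : ℝ) := ⟨δ / 4, δ / 2, by positivity, by linarith⟩
  have hβs : HasCompactSupport fun x => ((β x : ℝ) : ℂ) :=
    β.hasCompactSupport.comp_left (g := fun r : ℝ => (r : ℂ)) (by simp)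
  have hβc : ContDiff ℝ (⊤ : ℕ∞) fun x => ((β x : ℝ) : ℂ) := ofRealCLM.contDiff.comp β.contDiff
  let b : ℝ → 𝓢(ℝ, ℂ) := fun t =>
    HasCompactSupport.toSchwartzMap (f := fun x => ((β (x + t) : ℝ) : ℂ))
      (hβs.comp_homeomorph (Homeomorph.addRight t))
      (hβc.comp (contDiff_id.add contDiff_const))
  have hb : ∀ t x, b t x = ((β (x + t) : ℝ) : ℂ) := fun t x => rfl
  have hFb : ∀ t ξ, 𝓕 (b t) ξ = realChar ξ t * 𝓕 (b 0) ξ := by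
    intro t ξ
    rw [SchwartzMap.fourier_coe, SchwartzMap.fourier_coe, fourier_eq_integral_realChar,
      fourier_eq_integral_realChar, ← integral_const_mul,
      ← integral_add_right_eq_self (fun x => realChar ξ t * (b 0 x * realChar (-ξ) x)) t]
    congr 1; ext x
    rw [hb, hb, add_zero, realChar_add, realChar_neg_left ξ t]
    have : realChar ξ t * conj (realChar ξ t) = 1 := by
      rw [mul_conj, normSq_eq_norm_sq, norm_realChar]; simp
    linear_combination (-((β (x + t) : ℝ) : ℂ) * realChar (-ξ) x) * this
  let D : ℝ → ℝ := fun ξ => ‖𝓕 (b 0) ξ‖ ^ 2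
  let Δ : ℝ → ℝ := fun t => ∫ x, β x * β (x + t)
  have hD : Integrable D := by
    have h1 := ((𝓕 (b 0)).integrable (μ := volume)).norm
    obtain ⟨C, hC⟩ := (𝓕 (b 0)).decay 0 0
    have h2 : ∀ ξ, ‖𝓕 (b 0) ξ‖ ≤ C := fun ξ => by simpa using hC.2 ξ
    refine (h1.const_mul C).mono' (by fun_prop) (ae_of_all _ fun ξ => ?_)
    simp only [D]
    rw [Real.norm_of_nonneg (by positivity), sq]
    exact mul_le_mul_of_nonneg_right (h2 ξ) (norm_nonneg _)
  have hΔD : ∀ t, (Δ t : ℂ) = ∫ ξ, (D ξ : ℂ) * realChar ξ t := by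
    intro t
    have := SchwartzMap.integral_inner_fourier_fourier (b 0) (b t)
    simp only [RCLike.inner_apply, hFb t, hb, add_zero, conj_ofReal] at this
    simp only [Δ]
    rw [← integral_complex_ofReal]
    trans ∫ x, ((β (x + t) : ℝ) : ℂ) * ((β x : ℝ) : ℂ)
    · congr 1; ext x; push_cast; ring
    · rw [← this]; congr 1; ext ξ
      simp only [D]; push_cast
      rw [← Complex.conj_mul']; ring
  have hΔc : Continuous Δ := by
    have : Continuous fun t => (∫ ξ, (D ξ : ℂ) * realChar ξ t) := by
      refine continuous_of_dominated (bound := D) (fun t => ?_) (fun t => ae_of_all _ fun ξ => ?_)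
        hD (ae_of_all _ fun ξ => ?_)
      · exact (continuous_ofReal.comp_aestronglyMeasurable hD.aestronglyMeasurable).mul
          (continuous_realChar_left t).aestronglyMeasurable
      · rw [norm_mul, norm_realChar, mul_one, norm_real, Real.norm_of_nonneg (by positivity)]
      · exact continuous_const.mul (continuous_realChar ξ)
    have h2 : Δ = fun t => (∫ ξ, (D ξ : ℂ) * realChar ξ t).re := by
      ext t; rw [← hΔD]; simp
    rw [h2]; exact continuous_re.comp this
  have hΔ0 : ∀ t, 0 ≤ Δ t := fun t => integral_nonneg fun x => mul_nonneg β.nonneg β.nonneg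
  have hΔs : ∀ t, δ ≤ |t| → Δ t = 0 := by
    intro t ht
    have : ∀ x, β x * β (x + t) = 0 := by
      intro x
      by_cases hx : δ / 2 ≤ |x|
      · rw [β.zero_of_le_dist (by simpa using hx), zero_mul]
      · rw [β.zero_of_le_dist (x := x + t), mul_zero]
        simp only [dist_zero_right, Real.norm_eq_abs]
        show δ / 2 ≤ _
        have := abs_sub_abs_le_abs_sub t (-x)
        rw [abs_neg, sub_neg_eq_add, add_comm t] at this
        linarith
    simp [Δ, this]
  have hpos : 0 < Δ 0 := by
    simp only [Δ, add_zero]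
    refine Continuous.integral_pos_of_hasCompactSupport_nonneg_nonzero (x := 0)
      (β.continuous.mul β.continuous) (β.hasCompactSupport.mul_left)
      (fun x => mul_nonneg β.nonneg β.nonneg) ?_
    have : β 0 = 1 := β.one_of_mem_closedBall (by simp [β.rIn_pos.le])
    simp [this]
  refine ⟨Δ, D, hΔc, hΔ0, hΔs, ?_, fun ξ => by positivity, hD, hΔD⟩
  refine Continuous.integral_pos_of_hasCompactSupport_nonneg_nonzero (x := 0) hΔc ?_ hΔ0 hpos.ne'
  refine HasCompactSupport.of_support_subset_isCompact (isCompact_Icc (a := -δ) (b := δ)) ?_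
  intro t ht
  by_contra h
  refine ht (hΔs t ?_)
  by_contra! h2
  exact h ⟨(abs_lt.1 h2).1.le, (abs_lt.1 h2).2.le⟩

lemma BohrAP.exists_almostPeriods {k : ℝ → ℂ} (hk : BohrAP k) {ε : ℝ} (hε : 0 < ε) :
    ∃ l > (0 : ℝ), ∀ u, ∃ t, u < t ∧ t < u + l ∧ ∀ x, ‖k (x + t) - k x‖ ≤ ε := by
  obtain ⟨F, hF⟩ := hk.net ε hε
  obtain ⟨M, hM⟩ : ∃ M, ∀ s ∈ F, |s| ≤ M := by
    obtain ⟨M, hM⟩ := (F.image fun s => |s|).bddAbove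
    exact ⟨M, fun s hs => hM (by simpa using ⟨s, hs, rfl⟩)⟩
  have hM0 : 0 ≤ M := by
    obtain ⟨s, hs, _⟩ := hF 0
    exact (abs_nonneg _).trans (hM s hs)
  refine ⟨2 * M + 2, by linarith, fun u => ?_⟩
  obtain ⟨s, hs, h⟩ := hF (u + M + 1)
  have := abs_le.1 (hM s hs)
  refine ⟨u + M + 1 - s, by linarith, by linarith, fun x => ?_⟩
  have h2 := h (x - s)
  rwa [show x - s + (u + M + 1) = x + (u + M + 1 - s) by ring, sub_add_cancel] at h2

/-- A weighted average of an almost periodic function over a translate of the bump `Δ`, expressed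
through window Fourier integrals. -/
lemma integral_mul_bump_eq {k : ℝ → ℂ} (hk : BohrAP k) {Δ D : ℝ → ℝ}
    {δ : ℝ} (hδ : 0 < δ) (hΔs : ∀ t, δ ≤ |t| → Δ t = 0) (hD : Integrable D)
    (hΔD : ∀ t, (Δ t : ℂ) = ∫ ξ, (D ξ : ℂ) * realChar ξ t) {P x u : ℝ} (hP : δ + |u| ≤ P) :
    ∫ t, k (x + u + t) * (Δ t : ℂ) =
      ∫ ξ, (D ξ : ℂ) * realChar ξ (-u) * windowFourier k P x ξ := by
  have hP0 : -P ≤ P := by linarith [abs_nonneg u]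
  obtain ⟨C, hC⟩ := hk.bdd
  have e1 : ∫ t, k (x + u + t) * (Δ t : ℂ) = ∫ t in Ioc (-P) P, k (t + x) * (Δ (t - u) : ℂ) := by
    rw [← integral_sub_right_eq_self _ u, setIntegral_eq_integral_of_forall_compl_eq_zero]
    · congr 1; ext t; congr 2; ring
    · intro t ht
      rw [hΔs (t - u)]; · simp
      have := abs_sub_abs_le_abs_sub t u
      have : P ≤ |t| := by
        by_contra! h
        exact ht ⟨(abs_lt.1 h).1, (abs_lt.1 h).2.le⟩
      linarith
  have e2 : ∀ ξ, (D ξ : ℂ) * realChar ξ (-u) * windowFourier k P x ξ =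
      ∫ t in Ioc (-P) P, k (t + x) * ((D ξ : ℂ) * realChar ξ (t - u)) := by
    intro ξ
    rw [windowFourier, intervalIntegral.integral_of_le hP0, ← integral_const_mul]
    congr 1; ext t
    rw [sub_eq_add_neg, realChar_add]; ring
  have e3 : ∀ t, k (t + x) * (Δ (t - u) : ℂ) =
      ∫ ξ, k (t + x) * ((D ξ : ℂ) * realChar ξ (t - u)) := by
    intro t; rw [hΔD, integral_const_mul]
  rw [e1]
  simp_rw [e2, e3]
  refine integral_integral_swap ?_
  have hb : Integrable (fun p : ℝ × ℝ => C * ‖D p.2‖)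
      ((volume.restrict (Ioc (-P) P)).prod volume) :=
    Integrable.mul_prod (f := fun _ => C) (g := fun ξ => ‖D ξ‖) (integrable_const C) hD.norm
  refine hb.mono' ?_ (ae_of_all _ fun p => ?_)
  · refine AEStronglyMeasurable.mul ?_ (AEStronglyMeasurable.mul ?_ ?_)
    · exact (hk.continuous.comp (continuous_fst.add continuous_const)).aestronglyMeasurable
    · exact continuous_ofReal.comp_aestronglyMeasurable hD.aestronglyMeasurable.comp_snd
    · unfold realChar
      exact Continuous.aestronglyMeasurable (by fun_prop)
  · simp only [Function.uncurry]
    rw [norm_mul, norm_mul, norm_realChar, mul_one, norm_real]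
    exact mul_le_mul_of_nonneg_right (hC _) (norm_nonneg _)

/-- A Bohr almost periodic function all of whose Bohr means vanish is zero. -/
theorem BohrAP.eq_zero {k : ℝ → ℂ} (hk : BohrAP k) (h0 : ∀ ξ, HasMeanR k ξ 0) (x : ℝ) :
    k x = 0 := by
  by_contra hx
  set η : ℝ := ‖k x‖ / 6 with hη
  have hηpos : 0 < η := by have := norm_pos_iff.2 hx; positivity
  obtain ⟨l, hl, hap⟩ := hk.exists_almostPeriods hηpos
  obtain ⟨δ', hδ', hu⟩ := hk.unif η hηpos
  set δ := min δ' 1 with hδdef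
  have hδ : 0 < δ := by positivity
  obtain ⟨Δ, D, -, hΔ0, hΔs, hκ, hD0, hD, hΔD⟩ := exists_positive_definite_bump hδ
  set κ := ∫ t, Δ t with hκdef
  have hΔi : Integrable Δ := by
    by_contra h
    rw [hκdef, integral_undef h] at hκ
    exact lt_irrefl _ hκ
  set q : ℝ := 2 * (l + 1) + 1 with hq
  have hqpos : 0 < q := by positivity
  obtain ⟨n, hn⟩ := hk.exists_windowFourier_le h0
    (ε := η * κ / (q * (Δ 0 + 1))) (q := q) (by have := hΔ0 0; positivity) hqpos
  set N : ℕ := 2 ^ n with hN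
  have hN1 : (1 : ℝ) ≤ N := by rw [hN]; push_cast; exact one_le_pow₀ (by norm_num)
  set P : ℝ := 2 ^ n * q with hP
  have hPN : P = N * q := by rw [hP, hN]; push_cast; ring
  choose τ hτ1 hτ2 hτ3 using fun j : ℕ => hap (j * (l + 1))
  have hτpos : ∀ j, 0 < τ j := fun j => lt_of_le_of_lt (by positivity) (hτ1 j)
  have hτN : ∀ j < N, τ j ≤ N * (l + 1) := by
    intro j hj
    have : (j : ℝ) + 1 ≤ N := by exact_mod_cast hj
    have := hτ2 j
    nlinarith
  have hsep : ∀ i j, i < j → δ ≤ |τ j - τ i| := by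
    intro i j hij
    have h1 : (i : ℝ) + 1 ≤ j := by exact_mod_cast hij
    have h2 := hτ2 i
    have h3 := hτ1 j
    have h4 : δ ≤ 1 := min_le_right _ _
    have : 1 ≤ τ j - τ i := by nlinarith
    exact (h4.trans this).trans (le_abs_self _)
  -- each translated average is close to `κ * k x`
  have hclose : ∀ i j, ‖(∫ t, k (x + (τ i + τ j) + t) * (Δ t : ℂ)) - κ * k x‖ ≤ 3 * η * κ := by
    intro i j
    have hint : Integrable fun t => k (x + (τ i + τ j) + t) * (Δ t : ℂ) := by
      obtain ⟨C, hC⟩ := hk.bdd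
      refine hΔi.ofReal.bdd_mul (c := C) ?_ (ae_of_all _ fun t => hC _)
      exact (hk.continuous.comp (continuous_const.add continuous_id)).aestronglyMeasurable
    have e : (κ : ℂ) * k x = ∫ t, k x * (Δ t : ℂ) := by
      rw [integral_const_mul, hκdef, ← integral_complex_ofReal, mul_comm]
    have hint2 : Integrable fun t => k x * (Δ t : ℂ) := hΔi.ofReal.const_mul _
    rw [e, ← integral_sub hint hint2, hκdef, ← integral_const_mul]
    refine norm_integral_le_of_norm_le (hΔi.const_mul _) (ae_of_all _ fun t => ?_)
    rw [← sub_mul, norm_mul, norm_real, Real.norm_of_nonneg (hΔ0 t)]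
    by_cases ht : |t| ≤ δ
    · refine mul_le_mul_of_nonneg_right ?_ (hΔ0 t)
      have a1 := hτ3 i (x + τ j + t)
      have a2 := hτ3 j (x + t)
      have a3 := hu t (ht.trans (min_le_left _ _)) x
      rw [show x + τ j + t + τ i = x + (τ i + τ j) + t by ring] at a1
      rw [show x + t + τ j = x + τ j + t by ring] at a2
      have : k (x + (τ i + τ j) + t) - k x = (k (x + (τ i + τ j) + t) - k (x + τ j + t)) +
        (k (x + τ j + t) - k (x + t)) + (k (x + t) - k x) := by ring
      rw [this]
      refine (norm_add₃_le).trans ?_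
      linarith
    · rw [hΔs t (not_le.1 ht).le]; simp
  -- the double average in terms of window Fourier integrals
  let S : ℝ → ℂ := fun ξ => ∑ j ∈ Finset.range N, realChar ξ (-τ j)
  have hSc : Continuous S := continuous_finsetSum _ fun j _ => continuous_realChar_left _
  have hDc : ∀ u, Integrable fun ξ => (D ξ : ℂ) * realChar ξ u := fun u => by
    refine hD.ofReal.mul_bdd (c := 1) (continuous_realChar_left u).aestronglyMeasurable
      (ae_of_all _ fun ξ => (norm_realChar _ _).le)
  have hwc : Continuous fun ξ => windowFourier k P x ξ := by
    unfold windowFourier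
    refine intervalIntegral.continuous_parametric_intervalIntegral_of_continuous' ?_ _ _
    refine Continuous.mul (hk.continuous.comp (by fun_prop)) ?_
    unfold realChar; fun_prop
  have hsum : ∑ i ∈ Finset.range N, ∑ j ∈ Finset.range N,
      (∫ t, k (x + (τ i + τ j) + t) * (Δ t : ℂ)) =
      ∫ ξ, (D ξ : ℂ) * S ξ ^ 2 * windowFourier k P x ξ := by
    have e : ∀ i ∈ Finset.range N, ∀ j ∈ Finset.range N,
        (∫ t, k (x + (τ i + τ j) + t) * (Δ t : ℂ)) =
        ∫ ξ, (D ξ : ℂ) * realChar ξ (-(τ i + τ j)) * windowFourier k P x ξ := by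
      intro i hi j hj
      refine integral_mul_bump_eq hk hδ hΔs hD hΔD ?_
      have h1 := hτN i (Finset.mem_range.1 hi)
      have h2 := hτN j (Finset.mem_range.1 hj)
      have h4 : δ ≤ 1 := min_le_right _ _
      rw [abs_of_pos (add_pos (hτpos i) (hτpos j)), hPN, hq]
      nlinarith
    have hint : ∀ i j, Integrable fun ξ =>
        (D ξ : ℂ) * realChar ξ (-(τ i + τ j)) * windowFourier k P x ξ := fun i j =>
      (hDc _).mul_bdd hwc.aestronglyMeasurable (ae_of_all _ fun ξ => hn ξ x)
    rw [Finset.sum_congr rfl fun i hi => Finset.sum_congr rfl (e i hi)]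
    simp_rw [← integral_finsetSum _ fun j _ => hint _ j]
    rw [← integral_finsetSum _ fun i _ => integrable_finsetSum _ fun j _ => hint i j]
    congr 1; ext ξ
    simp only [S, sq, Finset.mul_sum, Finset.sum_mul, neg_add, realChar_add]
    exact Finset.sum_comm
  have hSS : ∫ ξ, D ξ * ‖S ξ‖ ^ 2 = N * Δ 0 := by
    have e : ∀ ξ, ((D ξ * ‖S ξ‖ ^ 2 : ℝ) : ℂ) = ∑ i ∈ Finset.range N, ∑ j ∈ Finset.range N,
        (D ξ : ℂ) * realChar ξ (τ j - τ i) := by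
      intro ξ
      push_cast
      rw [← mul_conj']
      simp only [S, map_sum]
      rw [Finset.sum_mul_sum, Finset.mul_sum]
      refine Finset.sum_congr rfl fun i _ => ?_
      rw [Finset.mul_sum]
      refine Finset.sum_congr rfl fun j _ => ?_
      rw [← realChar_neg_right, neg_neg, ← realChar_add]
      congr 2; ring
    apply ofReal_injective
    rw [← integral_complex_ofReal]
    simp_rw [e]
    rw [integral_finsetSum _ fun i _ => integrable_finsetSum _ fun j _ => hDc _]
    simp_rw [integral_finsetSum _ fun j _ => hDc _, ← hΔD]
    have : ∀ i ∈ Finset.range N, ∑ j ∈ Finset.range N, (Δ (τ j - τ i) : ℂ) = Δ 0 := by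
      intro i hi
      rw [Finset.sum_eq_single i]
      · simp
      · intro j _ hj
        rw [hΔs, ofReal_zero]
        rcases lt_or_gt_of_ne hj with h | h
        · rw [abs_sub_comm]; exact hsep _ _ h
        · exact hsep _ _ h
      · exact fun h => absurd hi h
    rw [Finset.sum_congr rfl this]
    simp
  have hSi : Integrable fun ξ => D ξ * ‖S ξ‖ ^ 2 := by
    refine hD.mul_bdd (c := (N : ℝ) ^ 2) (hSc.norm.pow 2).aestronglyMeasurable
      (ae_of_all _ fun ξ => ?_)
    rw [norm_pow, norm_norm]
    gcongr
    refine (norm_sum_le _ _).trans ?_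
    simp [norm_realChar]
  have hbound : ‖∫ ξ, (D ξ : ℂ) * S ξ ^ 2 * windowFourier k P x ξ‖ ≤
      N * Δ 0 * (η * κ / (q * (Δ 0 + 1)) * P) := by
    rw [← hSS, ← integral_mul_const]
    refine norm_integral_le_of_norm_le (hSi.mul_const _) (ae_of_all _ fun ξ => ?_)
    rw [norm_mul, norm_mul, norm_real, Real.norm_of_nonneg (hD0 ξ), norm_pow]
    exact mul_le_mul_of_nonneg_left (hn ξ x) (mul_nonneg (hD0 ξ) (by positivity))
  have hbound2 : N * Δ 0 * (η * κ / (q * (Δ 0 + 1)) * P) ≤ N ^ 2 * (η * κ) := by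
    have h00 := hΔ0 0
    rw [hPN]
    have : N * Δ 0 * (η * κ / (q * (Δ 0 + 1)) * (N * q)) =
      N ^ 2 * (η * κ) * (Δ 0 / (Δ 0 + 1)) := by field_simp
    rw [this]
    refine mul_le_of_le_one_right (by positivity) ?_
    rw [div_le_one (by positivity)]; linarith
  have hfin : ‖(N : ℂ) ^ 2 * (κ * k x)‖ ≤ N ^ 2 * (η * κ) + N ^ 2 * (3 * η * κ) := by
    have e : (N : ℂ) ^ 2 * (κ * k x) = (∑ i ∈ Finset.range N, ∑ j ∈ Finset.range N,
        (∫ t, k (x + (τ i + τ j) + t) * (Δ t : ℂ))) -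
        ∑ i ∈ Finset.range N, ∑ j ∈ Finset.range N,
          ((∫ t, k (x + (τ i + τ j) + t) * (Δ t : ℂ)) - κ * k x) := by
      simp only [Finset.sum_sub_distrib, Finset.sum_const, Finset.card_range, nsmul_eq_mul]
      ring
    rw [e, hsum]
    refine (norm_sub_le _ _).trans (add_le_add (hbound.trans hbound2) ?_)
    refine (norm_sum_le_of_le _ fun i _ => norm_sum_le_of_le _ fun j _ => hclose i j).trans ?_
    simp only [Finset.sum_const, Finset.card_range, nsmul_eq_mul]
    apply le_of_eq; ring
  rw [norm_mul, norm_mul, norm_pow, norm_real, Real.norm_of_nonneg hκ.le, Complex.norm_natCast] at hfin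
  have hx6 : ‖k x‖ = 6 * η := by rw [hη]; ring
  rw [hx6] at hfin
  have : 0 < (N : ℝ) ^ 2 * (η * κ) := by positivity
  nlinarith

lemma BohrAP.of_relDense {g : ℝ → ℂ} (hc : Continuous g)
    (h : ∀ ε > (0 : ℝ), RelDense {t : ℝ | ∀ x : ℝ, ‖g x - g (x + t)‖ ≤ ε}) : BohrAP g := by
  have hunif : ∀ ε > (0 : ℝ), ∃ δ > (0 : ℝ), ∀ h, |h| ≤ δ → ∀ x, ‖g (x + h) - g x‖ ≤ ε := by
    intro ε hε
    obtain ⟨l, hl, hd⟩ := h (ε / 3) (by positivity)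
    have huc := (isCompact_Icc (a := (-1 : ℝ)) (b := l + 1)).uniformContinuousOn_of_continuous
      hc.continuousOn
    rw [Metric.uniformContinuousOn_iff] at huc
    obtain ⟨δ, hδ, hu⟩ := huc (ε / 3) (by positivity)
    refine ⟨min (δ / 2) 1, by positivity, fun h hh x => ?_⟩
    obtain ⟨t, ht, h1, h2⟩ := hd (-x)
    have a1 := ht (x + h)
    have a2 := ht x
    have hh1 := abs_le.1 (hh.trans (min_le_right _ _))
    have a3 := hu (x + h + t) ⟨by linarith, by linarith⟩ (x + t) ⟨by linarith, by linarith⟩ (by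
      rw [Real.dist_eq, show x + h + t - (x + t) = h by ring]
      linarith [hh.trans (min_le_left _ _)])
    rw [dist_eq_norm] at a3
    rw [norm_sub_rev] at a2
    have : g (x + h) - g x = (g (x + h) - g (x + h + t)) + (g (x + h + t) - g (x + t)) +
      (g (x + t) - g x) := by ring
    rw [this]
    refine norm_add₃_le.trans ?_
    linarith
  refine ⟨hunif, ?_, ?_⟩
  · obtain ⟨l, hl, hd⟩ := h 1 one_pos
    obtain ⟨C, hC⟩ := (isCompact_Icc (a := (0 : ℝ)) (b := l)).exists_bound_of_continuousOn
      hc.continuousOn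
    refine ⟨C + 1, fun x => ?_⟩
    obtain ⟨t, ht, h1, h2⟩ := hd (-x)
    have a1 := ht x
    have a2 := hC (x + t) ⟨by linarith, by linarith⟩
    have := norm_sub_norm_le (g x) (g (x + t))
    linarith
  · intro ε hε
    obtain ⟨l, hl, hd⟩ := h (ε / 2) (by positivity)
    obtain ⟨δ, hδ, hu⟩ := hunif (ε / 2) (by positivity)
    refine ⟨(Finset.range (⌈l / δ⌉₊ + 1)).image fun n : ℕ => n * δ, fun s => ?_⟩
    obtain ⟨t, ht, h1, h2⟩ := hd (-s)
    have hp : 0 ≤ (s + t) / δ := div_nonneg (by linarith) hδ.le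
    refine ⟨⌊(s + t) / δ⌋₊ * δ, ?_, fun x => ?_⟩
    · refine Finset.mem_image_of_mem _ (Finset.mem_range.2 (Nat.lt_succ_of_le ?_))
      refine (Nat.floor_le_ceil _).trans (Nat.ceil_mono ?_)
      gcongr; linarith
    · have a1 := ht (x + s)
      have f1 := Nat.floor_le hp
      have f2 := Nat.lt_floor_add_one ((s + t) / δ)
      rw [le_div_iff₀ hδ] at f1
      rw [div_lt_iff₀ hδ] at f2
      have a2 := hu (s + t - ⌊(s + t) / δ⌋₊ * δ) (by rw [abs_of_nonneg] <;> linarith)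
        (x + ⌊(s + t) / δ⌋₊ * δ)
      rw [show x + ⌊(s + t) / δ⌋₊ * δ + (s + t - ⌊(s + t) / δ⌋₊ * δ) = x + s + t by ring] at a2
      refine (norm_sub_le_norm_sub_add_norm_sub _ (g (x + s + t)) _).trans ?_
      linarith

lemma BohrAP.add {k k' : ℝ → ℂ} (hk : BohrAP k) (hk' : BohrAP k') :
    BohrAP fun x => k x + k' x := by
  refine ⟨fun ε hε => ?_, ?_, fun ε hε => ?_⟩
  · obtain ⟨δ, hδ, h⟩ := hk.unif (ε / 2) (by positivity)
    obtain ⟨δ', hδ', h'⟩ := hk'.unif (ε / 2) (by positivity)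
    refine ⟨min δ δ', by positivity, fun t ht x => ?_⟩
    rw [add_sub_add_comm]
    have := h t (ht.trans (min_le_left _ _)) x
    have := h' t (ht.trans (min_le_right _ _)) x
    exact (norm_add_le _ _).trans (by linarith)
  · obtain ⟨C, hC⟩ := hk.bdd
    obtain ⟨C', hC'⟩ := hk'.bdd
    exact ⟨C + C', fun x => (norm_add_le _ _).trans (add_le_add (hC x) (hC' x))⟩
  · obtain ⟨F, hF⟩ := hk.net (ε / 4) (by positivity)
    obtain ⟨F', hF'⟩ := hk'.net (ε / 4) (by positivity)
    let P : ℝ × ℝ → ℝ → Prop := fun p s => (∀ x, ‖k (x + s) - k (x + p.1)‖ ≤ ε / 4) ∧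
      ∀ x, ‖k' (x + s) - k' (x + p.2)‖ ≤ ε / 4
    refine ⟨(F ×ˢ F').image fun p => Classical.epsilon (P p), fun s => ?_⟩
    obtain ⟨p, hp, h1⟩ := hF s
    obtain ⟨p', hp', h1'⟩ := hF' s
    have hP : P (p, p') (Classical.epsilon (P (p, p'))) :=
      Classical.epsilon_spec (p := P (p, p')) ⟨s, h1, h1'⟩
    refine ⟨_, Finset.mem_image_of_mem _ (Finset.mk_mem_product hp hp'), fun x => ?_⟩
    have a1 := hP.1 x
    have a2 := hP.2 x
    have a3 := h1 x
    have a4 := h1' x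
    rw [norm_sub_rev] at a1 a2
    rw [add_sub_add_comm]
    have b1 := norm_sub_le_norm_sub_add_norm_sub (k (x + s)) (k (x + p))
      (k (x + Classical.epsilon (P (p, p'))))
    have b2 := norm_sub_le_norm_sub_add_norm_sub (k' (x + s)) (k' (x + p'))
      (k' (x + Classical.epsilon (P (p, p'))))
    refine (norm_add_le _ _).trans ?_
    linarith

lemma BohrAP.const_mul {k : ℝ → ℂ} (hk : BohrAP k) (c : ℂ) : BohrAP fun x => c * k x := by
  have key : ∀ {ε r : ℝ} {z : ℂ}, 0 < ε → ‖z‖ ≤ ε / (‖c‖ + 1) → ‖c * z‖ ≤ ε := by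
    intro ε r z hε h
    have hc := norm_nonneg c
    rw [le_div_iff₀ (by positivity)] at h
    rw [norm_mul]
    nlinarith [norm_nonneg z]
  refine ⟨fun ε hε => ?_, ?_, fun ε hε => ?_⟩
  · obtain ⟨δ, hδ, h⟩ := hk.unif (ε / (‖c‖ + 1)) (by positivity)
    exact ⟨δ, hδ, fun t ht x => by rw [← mul_sub]; exact key (r := 0) hε (h t ht x)⟩
  · obtain ⟨C, hC⟩ := hk.bdd
    exact ⟨‖c‖ * C, fun x => by rw [norm_mul]; gcongr; exact hC x⟩
  · obtain ⟨F, hF⟩ := hk.net (ε / (‖c‖ + 1)) (by positivity)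
    refine ⟨F, fun s => ?_⟩
    obtain ⟨s', hs', h⟩ := hF s
    exact ⟨s', hs', fun x => by rw [← mul_sub]; exact key (r := 0) hε (h x)⟩

lemma BohrAP.sub {k k' : ℝ → ℂ} (hk : BohrAP k) (hk' : BohrAP k') :
    BohrAP fun x => k x - k' x := by
  simpa [sub_eq_add_neg] using hk.add (hk'.const_mul (-1))

lemma BohrAP.const (c : ℂ) : BohrAP fun _ => c :=
  ⟨fun ε hε => ⟨1, one_pos, fun _ _ _ => by simpa using hε.le⟩, ⟨‖c‖, fun _ => le_rfl⟩,
    fun ε hε => ⟨{0}, fun s => ⟨0, by simp, fun _ => by simpa using hε.le⟩⟩⟩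

lemma bohrAP_realChar (ξ : ℝ) : BohrAP (realChar ξ) := by
  rcases eq_or_ne ξ 0 with rfl | hξ
  · simpa only [show realChar 0 = fun _ => 1 from funext realChar_zero_left] using BohrAP.const 1
  have hξ' : 0 < |ξ| := abs_pos.2 hξ
  refine BohrAP.of_relDense (continuous_realChar ξ) fun ε hε => ⟨2 / |ξ|, by positivity, fun x => ?_⟩
  refine ⟨(⌊x * |ξ|⌋ + 1) / |ξ|, fun y => ?_, ?_, ?_⟩
  · have : realChar ξ ((⌊x * |ξ|⌋ + 1) / |ξ|) = 1 := by
      rw [realChar, Complex.exp_eq_one_iff]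
      rcases abs_cases ξ with ⟨h, _⟩ | ⟨h, _⟩
      · refine ⟨⌊x * |ξ|⌋ + 1, ?_⟩
        rw [h]; push_cast
        have : (ξ : ℂ) ≠ 0 := by exact_mod_cast hξ
        field_simp
      · refine ⟨-(⌊x * |ξ|⌋ + 1), ?_⟩
        rw [h]; push_cast
        have : (ξ : ℂ) ≠ 0 := by exact_mod_cast hξ
        field_simp
    rw [realChar_add, this]
    simpa using hε.le
  · rw [lt_div_iff₀ hξ']; exact Int.lt_floor_add_one _
  · rw [div_lt_iff₀ hξ', add_mul, div_mul_cancel₀ _ hξ'.ne']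
    linarith [Int.floor_le (x * |ξ|)]

lemma BohrAP.finset_sum {ι : Type*} (s : Finset ι) {k : ι → ℝ → ℂ} (hk : ∀ i, BohrAP (k i)) :
    BohrAP fun x => ∑ i ∈ s, k i x := by
  classical
  induction s using Finset.induction_on with
  | empty => simpa using BohrAP.const 0
  | insert i s hi ih =>
    simp only [Finset.sum_insert hi]
    exact (hk i).add ih

lemma BohrAP.of_approx {k : ℝ → ℂ}
    (h : ∀ ε > (0 : ℝ), ∃ k', BohrAP k' ∧ ∀ x, ‖k x - k' x‖ ≤ ε) : BohrAP k := by
  have key : ∀ {k' : ℝ → ℂ} {ε : ℝ}, (∀ x, ‖k x - k' x‖ ≤ ε / 3) → ∀ x y,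
      ‖k' x - k' y‖ ≤ ε / 3 → ‖k x - k y‖ ≤ ε := by
    intro k' ε h x y hxy
    have a := h x
    have b := h y
    rw [norm_sub_rev] at b
    have : k x - k y = (k x - k' x) + (k' x - k' y) + (k' y - k y) := by ring
    rw [this]
    refine norm_add₃_le.trans ?_
    linarith
  refine ⟨fun ε hε => ?_, ?_, fun ε hε => ?_⟩
  · obtain ⟨k', hk', h'⟩ := h (ε / 3) (by positivity)
    obtain ⟨δ, hδ, hu⟩ := hk'.unif (ε / 3) (by positivity)
    exact ⟨δ, hδ, fun t ht x => key h' _ _ (hu t ht x)⟩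
  · obtain ⟨k', hk', h'⟩ := h 1 one_pos
    obtain ⟨C, hC⟩ := hk'.bdd
    refine ⟨C + 1, fun x => ?_⟩
    have := norm_sub_norm_le (k x) (k' x)
    linarith [h' x, hC x]
  · obtain ⟨k', hk', h'⟩ := h (ε / 3) (by positivity)
    obtain ⟨F, hF⟩ := hk'.net (ε / 3) (by positivity)
    refine ⟨F, fun s => ?_⟩
    obtain ⟨s', hs', hx⟩ := hF s
    exact ⟨s', hs', fun x => key h' _ _ (hx x)⟩

lemma summable_mul_realChar {d : ℝ → ℂ} (hd : Summable fun l => ‖d l‖) (x : ℝ) :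
    Summable fun l => d l * realChar l x :=
  Summable.of_norm (by simpa [norm_realChar] using hd)

lemma BohrAP.tsum_realChar {d : ℝ → ℂ} (hd : Summable fun l => ‖d l‖) :
    BohrAP fun x => ∑' l, d l * realChar l x := by
  refine BohrAP.of_approx fun ε hε => ?_
  obtain ⟨F, hF⟩ := (((tendsto_tsum_compl_atTop_zero fun l => ‖d l‖).eventually
    (gt_mem_nhds hε))).exists
  refine ⟨_, BohrAP.finset_sum F fun l => (bohrAP_realChar l).const_mul (d l), fun x => ?_⟩
  rw [← (summable_mul_realChar hd x).sum_add_tsum_compl (s := F), add_sub_cancel_left]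
  refine (norm_tsum_le_tsum_norm ?_).trans ?_
  · simp only [norm_mul, norm_realChar, mul_one]
    exact hd.subtype _
  · simp only [norm_mul, norm_realChar, mul_one]
    exact hF.le

lemma hasMeanR_iff {f : ℝ → ℂ} {l : ℝ} {c : ℂ} : HasMeanR f l c ↔
    Tendsto (fun T : ℝ => (1 / (2 * (T : ℂ))) * ∫ x in (-T)..T, f x * realChar (-l) x)
      atTop (𝓝 c) := by
  simp only [HasMeanR, exp_neg_eq_realChar]

lemma norm_mean_le {f : ℝ → ℂ} {C T : ℝ} (hT : 0 < T) (hf : ∀ x, ‖f x‖ ≤ C) :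
    ‖(1 / (2 * (T : ℂ))) * ∫ x in (-T)..T, f x‖ ≤ C := by
  have h := intervalIntegral.norm_integral_le_of_norm_le_const (a := -T) (b := T)
    (f := f) (C := C) (fun x _ => hf x)
  rw [sub_neg_eq_add, abs_of_pos (by linarith)] at h
  rw [norm_mul, norm_div, norm_mul, norm_real, Real.norm_of_nonneg hT.le]
  simp only [norm_one, Complex.norm_ofNat]
  calc _ ≤ 1 / (2 * T) * (C * (T + T)) := by gcongr
    _ = C := by field_simp; ring

lemma HasMeanR.sub {f g : ℝ → ℂ} (hf : Continuous f) (hg : Continuous g) {l : ℝ} {c d : ℂ}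
    (h : HasMeanR f l c) (h' : HasMeanR g l d) : HasMeanR (fun x => f x - g x) l (c - d) := by
  rw [hasMeanR_iff] at *
  refine (h.sub h').congr fun T => ?_
  rw [← mul_sub, ← intervalIntegral.integral_sub]
  · simp only [sub_mul]
  · exact (hf.mul (continuous_realChar _)).intervalIntegrable _ _
  · exact (hg.mul (continuous_realChar _)).intervalIntegrable _ _

lemma HasMeanR.comp_add {f : ℝ → ℂ} (hf : Continuous f) {C : ℝ} (hC : ∀ x, ‖f x‖ ≤ C)
    {l : ℝ} {c : ℂ} (h : HasMeanR f l c) (u : ℝ) :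
    HasMeanR (fun x => f (x + u)) l (c * realChar l u) := by
  rw [hasMeanR_iff] at *
  have hc : Continuous fun x => f x * realChar (-l) x := hf.mul (continuous_realChar _)
  have hC' : ∀ x, ‖f x * realChar (-l) x‖ ≤ C := fun x => by
    rw [norm_mul, norm_realChar, mul_one]; exact hC x
  have e : ∀ T : ℝ, ∫ x in (-T)..T, f (x + u) * realChar (-l) x =
      (∫ x in (-T + u)..(T + u), f x * realChar (-l) x) * realChar l u := by
    intro T
    rw [← intervalIntegral.integral_comp_add_right (fun x => f x * realChar (-l) x) u,
      ← intervalIntegral.integral_mul_const]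
    congr 1; ext x
    have : realChar (-l) u * realChar l u = 1 := by rw [← realChar_add_left]; simp
    rw [realChar_add]
    linear_combination (-f (x + u) * realChar (-l) x) * this
  have hz : Tendsto (fun T : ℝ => (1 / (2 * (T : ℂ))) *
      ((∫ x in (-T + u)..(T + u), f x * realChar (-l) x) -
        ∫ x in (-T)..T, f x * realChar (-l) x)) atTop (𝓝 0) := by
    rw [tendsto_zero_iff_norm_tendsto_zero]
    have hb : Tendsto (fun T : ℝ => (C * |u|) / T) atTop (𝓝 0) := tendsto_id.const_div_atTop _
    refine squeeze_zero' (Eventually.of_forall fun T => norm_nonneg _) ?_ hb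
    filter_upwards [eventually_gt_atTop 0] with T hT
    rw [norm_mul, norm_div, norm_mul, norm_real, Real.norm_of_nonneg hT.le]
    simp only [norm_one, Complex.norm_ofNat]
    calc _ ≤ 1 / (2 * T) * (2 * C * |u|) := by
          gcongr; exact norm_integral_shift_sub_le hc hC' _ _ _
      _ = _ := by field_simp
  have := (hz.add h).mul_const (realChar l u)
  rw [zero_add] at this
  refine this.congr fun T => ?_
  rw [e]; ring

lemma hasMeanR_realChar (l ξ : ℝ) : HasMeanR (realChar l) ξ (if l = ξ then 1 else 0) := by
  rw [hasMeanR_iff]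
  split_ifs with h
  · subst h
    refine tendsto_const_nhds.congr' ?_
    filter_upwards [eventually_gt_atTop 0] with T hT
    have : ∀ x, realChar l x * realChar (-l) x = 1 := fun x => by
      rw [← realChar_add_left]; simp
    simp only [this, intervalIntegral.integral_const, sub_neg_eq_add, real_smul]
    have : (T : ℂ) ≠ 0 := by exact_mod_cast hT.ne'
    push_cast; field_simp; norm_num
  · have hη : l - ξ ≠ 0 := sub_ne_zero.2 h
    have hc : (2 * Real.pi * (l - ξ) : ℂ) * I ≠ 0 := by
      refine mul_ne_zero (mul_ne_zero (by simp [Real.pi_ne_zero]) (by exact_mod_cast hη)) I_ne_zero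
    rw [tendsto_zero_iff_norm_tendsto_zero]
    have hb : Tendsto (fun T : ℝ => (1 / ‖(2 * Real.pi * (l - ξ) : ℂ) * I‖) / T) atTop (𝓝 0) :=
      tendsto_id.const_div_atTop _
    refine squeeze_zero' (Eventually.of_forall fun T => norm_nonneg _) ?_ hb
    filter_upwards [eventually_gt_atTop 0] with T hT
    have e : ∫ x in (-T)..T, realChar l x * realChar (-ξ) x =
        ∫ x in (-T)..T, cexp ((2 * Real.pi * (l - ξ) : ℂ) * I * x) := by
      congr 1; ext x
      rw [← realChar_add_left, realChar]
      congr 1; push_cast; ring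
    have en : ∀ x : ℝ, ‖cexp ((2 * Real.pi * (l - ξ) : ℂ) * I * x)‖ = 1 := fun x => by
      rw [← norm_realChar (l - ξ) x, realChar]
      congr 2; push_cast; ring
    rw [e, integral_exp_mul_complex hc, norm_mul, norm_div, norm_mul, norm_real,
      Real.norm_of_nonneg hT.le, norm_div]
    simp only [norm_one, Complex.norm_ofNat]
    calc _ ≤ 1 / (2 * T) * ((1 + 1) / ‖(2 * Real.pi * (l - ξ) : ℂ) * I‖) := by
          gcongr
          refine (norm_sub_le _ _).trans ?_
          rw [en, en]
      _ = _ := by field_simp; norm_num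

lemma HasMeanR.tsum_realChar {d : ℝ → ℂ} (hd : Summable fun l => ‖d l‖) (ξ : ℝ) :
    HasMeanR (fun x => ∑' l, d l * realChar l x) ξ (d ξ) := by
  rw [hasMeanR_iff]
  have hdc : (Function.support d).Countable :=
    hd.countable_support.mono fun l hl => by simpa using hl
  have e : ∀ T : ℝ, (1 / (2 * (T : ℂ))) *
      ∫ x in (-T)..T, (∑' l, d l * realChar l x) * realChar (-ξ) x =
      ∑' l, d l * ((1 / (2 * (T : ℂ))) * ∫ x in (-T)..T, realChar l x * realChar (-ξ) x) := by
    intro T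
    have h1 : HasSum (fun l : Function.support d =>
        ∫ x in (-T)..T, (d l * realChar l x) * realChar (-ξ) x)
        (∫ x in (-T)..T, (∑' l, d l * realChar l x) * realChar (-ξ) x) := by
      have := hdc.to_subtype
      refine intervalIntegral.hasSum_integral_of_dominated_convergence
        (fun l _ => ‖d l‖) (fun l => ?_) (fun l => ?_) ?_ ?_ ?_
      · exact ((continuous_const.mul (continuous_realChar _)).mul
          (continuous_realChar _)).aestronglyMeasurable
      · refine ae_of_all _ fun x _ => ?_
        simp [norm_realChar]
      · exact ae_of_all _ fun x _ => hd.subtype _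
      · exact intervalIntegrable_const
      · refine ae_of_all _ fun x _ => HasSum.mul_right _ ?_
        refine (hasSum_subtype_iff_of_support_subset (f := fun l => d l * realChar l x) ?_).2
          (summable_mul_realChar hd x).hasSum
        intro l hl
        simp only [Function.mem_support] at *
        exact left_ne_zero_of_mul hl
    have h2 := (hasSum_subtype_iff_of_support_subset
      (f := fun l => ∫ x in (-T)..T, (d l * realChar l x) * realChar (-ξ) x) (by
        intro l hl hl'
        simp only [Function.mem_support] at *
        simp [hl'] at hl)).1 h1
    rw [← (h2.mul_left _).tsum_eq]
    congr 1; ext l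
    simp only [mul_assoc]
    rw [intervalIntegral.integral_const_mul]
    ring
  simp_rw [e]
  have hl : d ξ = ∑' l, d l * (if l = ξ then 1 else 0) := by
    rw [tsum_eq_single ξ]
    · simp
    · intro l hl; simp [hl]
  rw [hl]
  refine tendsto_tsum_of_dominated_convergence hd (fun l => ?_) ?_
  · exact (hasMeanR_iff.1 (hasMeanR_realChar l ξ)).const_mul _
  · filter_upwards [eventually_gt_atTop 0] with T hT l
    rw [norm_mul]
    refine mul_le_of_le_one_right (norm_nonneg _) (norm_mean_le hT fun x => ?_)
    simp [norm_realChar]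

lemma BohrAP.integrable_mul {g ψ : ℝ → ℂ} (hg : BohrAP g) (hψ : Integrable ψ) (s : ℝ) :
    Integrable fun x => ψ x * g (x + s) := by
  obtain ⟨C, hC⟩ := hg.bdd
  exact hψ.mul_bdd (c := C) (hg.continuous.comp (by fun_prop)).aestronglyMeasurable
    (ae_of_all _ fun x => hC _)

lemma BohrAP.smooth {g ψ : ℝ → ℂ} (hg : BohrAP g) (hψ : Integrable ψ) :
    BohrAP fun s => ∫ x, ψ x * g (x + s) := by
  set M := ∫ x, ‖ψ x‖ with hM
  have hM0 : 0 ≤ M := integral_nonneg fun _ => norm_nonneg _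
  have key : ∀ {ε s s' : ℝ}, 0 < ε → (∀ x, ‖g (x + s) - g (x + s')‖ ≤ ε / (M + 1)) →
      ‖(∫ x, ψ x * g (x + s)) - ∫ x, ψ x * g (x + s')‖ ≤ ε := by
    intro ε s s' hε h
    rw [← integral_sub (hg.integrable_mul hψ s) (hg.integrable_mul hψ s')]
    refine (norm_integral_le_of_norm_le (hψ.norm.mul_const (ε / (M + 1)))
      (ae_of_all _ fun x => ?_)).trans ?_
    · rw [← mul_sub, norm_mul]
      exact mul_le_mul_of_nonneg_left (h x) (norm_nonneg _)
    · rw [integral_mul_const, ← hM, mul_div_assoc', div_le_iff₀ (by positivity)]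
      nlinarith
  refine ⟨fun ε hε => ?_, ?_, fun ε hε => ?_⟩
  · obtain ⟨δ, hδ, h⟩ := hg.unif (ε / (M + 1)) (by positivity)
    refine ⟨δ, hδ, fun t ht s => key hε fun x => ?_⟩
    rw [← add_assoc]; exact h t ht _
  · obtain ⟨C, hC⟩ := hg.bdd
    refine ⟨M * C, fun s => ?_⟩
    rw [hM, ← integral_mul_const]
    refine norm_integral_le_of_norm_le (hψ.norm.mul_const _) (ae_of_all _ fun x => ?_)
    rw [norm_mul]
    exact mul_le_mul_of_nonneg_left (hC _) (norm_nonneg _)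
  · obtain ⟨F, hF⟩ := hg.net (ε / (M + 1)) (by positivity)
    refine ⟨F, fun s => ?_⟩
    obtain ⟨s', hs', h⟩ := hF s
    refine ⟨s', hs', fun y => key hε fun x => ?_⟩
    rw [← add_assoc, ← add_assoc]; exact h _

lemma HasMeanR.smooth {g ψ : ℝ → ℂ} (hg : BohrAP g) (hψ : Integrable ψ) {l : ℝ} {c : ℂ}
    (h : HasMeanR g l c) :
    HasMeanR (fun s => ∫ x, ψ x * g (x + s)) l (c * ∫ x, ψ x * realChar l x) := by
  obtain ⟨C, hC⟩ := hg.bdd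
  rw [hasMeanR_iff]
  have e : ∀ T > (0 : ℝ), ∫ x, ψ x * ((1 / (2 * (T : ℂ))) *
        ∫ s in (-T)..T, g (s + x) * realChar (-l) s) =
      (1 / (2 * (T : ℂ))) * ∫ s in (-T)..T, (∫ x, ψ x * g (x + s)) * realChar (-l) s := by
    intro T hT
    have hTT : -T ≤ T := by linarith
    simp_rw [intervalIntegral.integral_of_le hTT, mul_left_comm (ψ _)]
    rw [integral_const_mul]
    congr 1
    simp_rw [← integral_const_mul, ← integral_mul_const]
    rw [integral_integral_swap]
    · congr 1; ext s; congr 1; ext x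
      rw [add_comm s x]; ring
    · have hb : Integrable (fun p : ℝ × ℝ => ‖ψ p.1‖ * C)
          (volume.prod (volume.restrict (Ioc (-T) T))) :=
        Integrable.mul_prod (f := fun x => ‖ψ x‖) (g := fun _ => C) hψ.norm (integrable_const C)
      refine hb.mono' ?_ (ae_of_all _ fun p => ?_)
      · refine AEStronglyMeasurable.mul hψ.aestronglyMeasurable.comp_fst
          (AEStronglyMeasurable.mul ?_ ?_)
        · exact (hg.continuous.comp (by fun_prop)).aestronglyMeasurable
        · exact ((continuous_realChar _).comp continuous_snd).aestronglyMeasurable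
      · simp only [Function.uncurry]
        rw [norm_mul, norm_mul, norm_realChar, mul_one]
        exact mul_le_mul_of_nonneg_left (hC _) (norm_nonneg _)
  have hlim : Tendsto (fun T : ℝ => ∫ x, ψ x * ((1 / (2 * (T : ℂ))) *
        ∫ s in (-T)..T, g (s + x) * realChar (-l) s)) atTop
      (𝓝 (∫ x, ψ x * (c * realChar l x))) := by
    refine tendsto_integral_filter_of_dominated_convergence (fun x => ‖ψ x‖ * C) ?_ ?_
      (hψ.norm.mul_const _) (ae_of_all _ fun x => ?_)
    · refine Eventually.of_forall fun T => hψ.aestronglyMeasurable.mul ?_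
      refine (Continuous.aestronglyMeasurable ?_)
      refine continuous_const.mul
        (intervalIntegral.continuous_parametric_intervalIntegral_of_continuous' ?_ _ _)
      exact (hg.continuous.comp (by fun_prop)).mul ((continuous_realChar _).comp continuous_snd)
    · filter_upwards [eventually_gt_atTop 0] with T hT
      refine ae_of_all _ fun x => ?_
      rw [norm_mul]
      refine mul_le_mul_of_nonneg_left (norm_mean_le hT fun s => ?_) (norm_nonneg _)
      rw [norm_mul, norm_realChar, mul_one]
      exact hC _
    · exact (hasMeanR_iff.1 (h.comp_add hg.continuous hC x)).const_mul _
  simp_rw [mul_left_comm (ψ _) c] at hlim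
  rw [integral_const_mul] at hlim
  refine hlim.congr' ?_
  filter_upwards [eventually_gt_atTop 0] with T hT using e T hT

open scoped FourierTransform SchwartzMap in
lemma exists_schwartz_FT {φ : ℝ → ℂ} (hφ : ContDiff ℝ (⊤ : ℕ∞) φ) (hs : HasCompactSupport φ) :
    ∃ ψ : 𝓢(ℝ, ℂ), (∀ x, ψ x = FT φ x) ∧ ∀ l, ∫ x, ψ x * realChar l x = φ l := by
  let φ' : 𝓢(ℝ, ℂ) := hs.toSchwartzMap hφ
  have hcoe : ∀ x, φ' x = φ x := fun _ => rfl
  refine ⟨𝓕 φ', fun x => ?_, fun l => ?_⟩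
  · rw [SchwartzMap.fourier_coe, fourier_eq_integral_realChar, FT]
    congr 1; ext t
    rw [hcoe, exp_neg_eq_realChar, realChar_neg_left, realChar_neg_left, realChar_comm]
  · rw [← fourierInv_eq_integral_realChar, ← SchwartzMap.fourierInv_coe,
      FourierTransform.fourierInv_fourier_eq, hcoe]

/-- Summation formula for a Bohr almost periodic function. -/
theorem BohrAP.integral_FT_mul {g c : ℝ → ℂ} (hg : BohrAP g) (hc : ∀ l, HasMeanR g l (c l))
    {φ : ℝ → ℂ} (hφ : ContDiff ℝ (⊤ : ℕ∞) φ) (hs : HasCompactSupport φ)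
    (hsum : Summable fun l => ‖c l * φ l‖) : ∫ x, FT φ x * g x = ∑' l, c l * φ l := by
  obtain ⟨ψ, hψ, hinv⟩ := exists_schwartz_FT hφ hs
  have hψi : Integrable ψ := ψ.integrable
  have hk := (hg.smooth hψi).sub (BohrAP.tsum_realChar hsum)
  have h0 : ∀ l, HasMeanR (fun s => (∫ x, ψ x * g (x + s)) -
      ∑' l, c l * φ l * realChar l s) l 0 := by
    intro l
    have h1 := (hc l).smooth hg hψi
    rw [hinv] at h1
    have h2 := HasMeanR.tsum_realChar hsum l
    simpa using h1.sub (hg.smooth hψi).continuous (BohrAP.tsum_realChar hsum).continuous h2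
  have := hk.eq_zero h0 0
  simp only [add_zero, realChar_zero_right, mul_one, sub_eq_zero, hψ] at this
  exact this

lemma HasMeanR.add {f g : ℝ → ℂ} (hf : Continuous f) (hg : Continuous g) {l : ℝ} {c d : ℂ}
    (h : HasMeanR f l c) (h' : HasMeanR g l d) : HasMeanR (fun x => f x + g x) l (c + d) := by
  rw [hasMeanR_iff] at *
  refine (h.add h').congr fun T => ?_
  rw [← mul_add, ← intervalIntegral.integral_add]
  · simp only [add_mul]
  · exact (hf.mul (continuous_realChar _)).intervalIntegrable _ _
  · exact (hg.mul (continuous_realChar _)).intervalIntegrable _ _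

open scoped ComplexConjugate in
lemma HasMeanR.conj {f : ℝ → ℂ} {l : ℝ} {c : ℂ} (h : HasMeanR f (-l) c) :
    HasMeanR (fun x => conj (f x)) l (conj c) := by
  rw [hasMeanR_iff] at *
  refine ((continuous_conj.tendsto c).comp h).congr fun T => ?_
  simp only [Function.comp, map_mul, map_div₀, map_one, map_ofNat, conj_ofReal]
  congr 1
  simp only [intervalIntegral, map_sub, ← integral_conj, map_mul, ← realChar_neg_left, neg_neg]

/-- A nonnegative function has its Bohr means dominated by the mean at frequency zero. -/
lemma HasMeanR.norm_le_of_nonneg {f : ℝ → ℝ} (hf : Continuous f) (h0 : ∀ x, 0 ≤ f x) {l : ℝ}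
    {c d : ℂ} (h : HasMeanR (fun x => (f x : ℂ)) l c) (h' : HasMeanR (fun x => (f x : ℂ)) 0 d) :
    ‖c‖ ≤ ‖d‖ := by
  rw [hasMeanR_iff] at *
  refine le_of_tendsto_of_tendsto h.norm h'.norm ?_
  filter_upwards [eventually_gt_atTop 0] with T hT
  have hTT : -T ≤ T := by linarith
  rw [norm_mul, norm_mul]
  refine mul_le_mul_of_nonneg_left ?_ (norm_nonneg _)
  simp only [neg_zero, realChar_zero_left, mul_one]
  rw [intervalIntegral.integral_ofReal, norm_real,
    Real.norm_of_nonneg (intervalIntegral.integral_nonneg hTT fun x _ => h0 x)]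
  refine intervalIntegral.norm_integral_le_of_norm_le hTT (ae_of_all _ fun x _ => ?_)
    (hf.intervalIntegrable _ _)
  rw [norm_mul, norm_realChar, mul_one, norm_real, Real.norm_of_nonneg (h0 x)]

lemma APH.continuous_line {f : ℂ → ℂ} (hf : APH f) {y : ℝ} (hy : 0 < y) :
    Continuous fun x : ℝ => f ((x : ℂ) + (y : ℂ) * I) :=
  hf.1.continuousOn.comp_continuous (by fun_prop) fun x => by simpa [UHP] using hy

lemma APH.bohrAP_line {f : ℂ → ℂ} (hf : APH f) {y : ℝ} (hy : 0 < y) :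
    BohrAP fun x : ℝ => f ((x : ℂ) + (y : ℂ) * I) := by
  refine BohrAP.of_relDense (hf.continuous_line hy) fun ε hε => ?_
  obtain ⟨τ, ⟨l, hl, h⟩, hτ⟩ := hf.2 (y / 2) (2 * y) ε (by positivity) (by linarith) hε
  refine ⟨l, hl, fun x => ?_⟩
  obtain ⟨t, ht, h'⟩ := h x
  refine ⟨t, fun s => ?_, h'⟩
  have := hτ t ht (s + y * I) (by simpa using by linarith) (by simpa using by linarith)
  rwa [show (s : ℂ) + y * I + t = ((s + t : ℝ) : ℂ) + y * I by push_cast; ring] at this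

open scoped ComplexConjugate in
lemma BohrAP.conj {k : ℝ → ℂ} (hk : BohrAP k) : BohrAP fun x => conj (k x) := by
  obtain ⟨C, hC⟩ := hk.bdd
  refine ⟨fun ε hε => ?_, ⟨C, fun x => by rw [RCLike.norm_conj]; exact hC x⟩, fun ε hε => ?_⟩
  · obtain ⟨δ, hδ, h⟩ := hk.unif ε hε
    exact ⟨δ, hδ, fun t ht x => by rw [← map_sub, RCLike.norm_conj]; exact h t ht x⟩
  · obtain ⟨F, hF⟩ := hk.net ε hε
    refine ⟨F, fun s => ?_⟩
    obtain ⟨s', hs', h⟩ := hF s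
    exact ⟨s', hs', fun x => by rw [← map_sub, RCLike.norm_conj]; exact h x⟩

lemma APH.bohrAP_re {f : ℂ → ℂ} (hf : APH f) {y : ℝ} (hy : 0 < y) :
    BohrAP fun x : ℝ => ((2 * (f ((x : ℂ) + (y : ℂ) * I)).re : ℝ) : ℂ) := by
  have := (hf.bohrAP_line hy).add (hf.bohrAP_line hy).conj
  simpa only [add_conj] using this

lemma HasMeanAt.hasMeanR {f : ℂ → ℂ} {y l : ℝ} {c : ℂ} (h : HasMeanAt f y l c) :
    HasMeanR (fun x : ℝ => f ((x : ℂ) + (y : ℂ) * I)) l (c * Real.exp (-(2 * Real.pi * l * y))) := by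
  rw [hasMeanR_iff]
  refine (Tendsto.mul_const (Real.exp (-(2 * Real.pi * l * y)) : ℂ) h).congr fun T => ?_
  rw [mul_assoc, ← intervalIntegral.integral_mul_const]
  congr 2; ext x
  rw [← exp_neg_eq_realChar, ofReal_exp, mul_assoc, ← Complex.exp_add]
  congr 2
  push_cast
  linear_combination (-2 * Real.pi * l * y : ℂ) * I_sq

section Means

open scoped ComplexConjugate

variable {f : ℂ → ℂ} {m : ℝ → ℂ}

lemma APH.hasMeanR_re (hf : APH f) (hm : ∀ l : ℝ, ∀ y > (0 : ℝ), HasMeanAt f y l (m l))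
    {y : ℝ} (hy : 0 < y) (l : ℝ) :
    HasMeanR (fun x : ℝ => ((2 * (f ((x : ℂ) + (y : ℂ) * I)).re : ℝ) : ℂ)) l
      (m l * Real.exp (-(2 * Real.pi * l * y)) +
        conj (m (-l)) * Real.exp (2 * Real.pi * l * y)) := by
  have h1 := (hm l y hy).hasMeanR
  have h2 := (hm (-l) y hy).hasMeanR.conj
  rw [map_mul, conj_ofReal, show -(2 * Real.pi * -l * y) = 2 * Real.pi * l * y by ring] at h2
  have := h1.add (hf.continuous_line hy)
    (continuous_conj.comp (hf.continuous_line hy)) h2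
  simpa only [Function.comp, add_conj] using this

lemma APH.mean_eq_zero_of_neg (hf : APH f) (hre : ∀ z ∈ UHP, 0 ≤ (f z).re)
    (hm : ∀ l : ℝ, ∀ y > (0 : ℝ), HasMeanAt f y l (m l)) {l : ℝ} (hl : l < 0) : m l = 0 := by
  by_contra hne
  have key : ∀ y > (0 : ℝ), ‖m l‖ * Real.exp (-(2 * Real.pi * l * y)) ≤
      ‖m 0 + conj (m 0)‖ + ‖m (-l)‖ := by
    intro y hy
    have h0 := hf.hasMeanR_re hm hy 0
    simp only [mul_zero, zero_mul, neg_zero, Real.exp_zero, ofReal_one, mul_one] at h0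
    have h1 := HasMeanR.norm_le_of_nonneg (f := fun x : ℝ => 2 * (f ((x : ℂ) + (y : ℂ) * I)).re)
      (continuous_const.mul (continuous_re.comp (hf.continuous_line hy)))
      (fun x => mul_nonneg zero_le_two (hre _ (by simpa [UHP] using hy)))
      (hf.hasMeanR_re hm hy l) h0
    have h2 := norm_sub_le (m l * Real.exp (-(2 * Real.pi * l * y)) +
        conj (m (-l)) * Real.exp (2 * Real.pi * l * y)) (conj (m (-l)) * Real.exp (2 * Real.pi * l * y))
    rw [add_sub_cancel_right, norm_mul, norm_mul, norm_real, norm_real, RCLike.norm_conj,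
      Real.norm_of_nonneg (Real.exp_pos _).le, Real.norm_of_nonneg (Real.exp_pos _).le] at h2
    have h3 : Real.exp (2 * Real.pi * l * y) ≤ 1 := by
      rw [Real.exp_le_one_iff]
      have := mul_pos Real.pi_pos hy
      nlinarith
    nlinarith [norm_nonneg (m (-l))]
  have hlim : Tendsto (fun y : ℝ => ‖m l‖ * Real.exp (-(2 * Real.pi * l * y))) atTop atTop := by
    refine (Real.tendsto_exp_atTop.comp ?_).const_mul_atTop (norm_pos_iff.2 hne)
    have := tendsto_id.const_mul_atTop (α := ℝ) (show 0 < 2 * Real.pi * (-l) by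
      have := Real.pi_pos; nlinarith)
    refine this.congr fun y => by simp only [id]; ring
  obtain ⟨y, hy1, hy2⟩ := ((hlim.eventually_gt_atTop _).and (eventually_gt_atTop 0)).exists
  exact absurd (key y hy2) (not_le.2 hy1)

variable {a : ℝ → ℂ}

lemma APH.hasMeanR_re_eq (hf : APH f) (hre : ∀ z ∈ UHP, 0 ≤ (f z).re)
    (hm : ∀ l : ℝ, ∀ y > (0 : ℝ), HasMeanAt f y l (m l))
    (ha : ∀ l > (0 : ℝ), a l = m l) (ha0 : a 0 = 2 * ((m 0).re : ℂ))
    (haneg : ∀ l > (0 : ℝ), a (-l) = conj (a l)) {y : ℝ} (hy : 0 < y) (l : ℝ) :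
    HasMeanR (fun x : ℝ => ((2 * (f ((x : ℂ) + (y : ℂ) * I)).re : ℝ) : ℂ)) l
      (a l * Real.exp (-(2 * Real.pi * |l| * y))) := by
  convert hf.hasMeanR_re hm hy l using 1
  rcases lt_trichotomy l 0 with h | rfl | h
  · have h1 : a l = conj (m (-l)) := by
      rw [← ha (-l) (by linarith), ← haneg (-l) (by linarith), neg_neg]
    rw [hf.mean_eq_zero_of_neg hre hm h, h1, abs_of_neg h]
    simp
  · simp [ha0, add_conj]
  · rw [hf.mean_eq_zero_of_neg hre hm (neg_lt_zero.2 h), ha l h, abs_of_pos h]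
    simp

lemma antipodal_of (ha0 : a 0 = 2 * ((m 0).re : ℂ))
    (haneg : ∀ l > (0 : ℝ), a (-l) = conj (a l)) : Antipodal a := by
  intro l
  rcases lt_trichotomy l 0 with h | rfl | h
  · have := haneg (-l) (by linarith)
    rw [neg_neg] at this
    rw [this, conj_conj]
  · rw [neg_zero, ha0, map_mul, conj_ofReal, map_ofNat]
  · exact haneg l h

lemma locSummable_of (hms : LocSummable m)
    (ha : ∀ l > (0 : ℝ), a l = m l) (ha0 : a 0 = 2 * ((m 0).re : ℂ))
    (haneg : ∀ l > (0 : ℝ), a (-l) = conj (a l)) : LocSummable a := by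
  have hle : ∀ l, ‖a l‖ ≤ ‖m l‖ + ‖m (-l)‖ := by
    intro l
    rcases lt_trichotomy l 0 with h | rfl | h
    · have := haneg (-l) (by linarith)
      rw [neg_neg, ha (-l) (by linarith)] at this
      rw [this, RCLike.norm_conj]
      linarith [norm_nonneg (m l)]
    · rw [ha0, norm_mul, norm_real, neg_zero, Complex.norm_ofNat, Real.norm_eq_abs]
      linarith [abs_re_le_norm (m 0)]
    · rw [ha l h]
      linarith [norm_nonneg (m (-l))]
  refine ⟨(hms.1.union (hms.1.preimage neg_injective)).mono fun l hl => ?_, fun T hT => ?_⟩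
  · by_contra hc
    simp only [mem_union, Function.mem_support, mem_preimage, not_or, not_not] at hc
    have := hle l
    rw [hc.1, hc.2] at this
    simp only [norm_zero, add_zero, norm_le_zero_iff] at this
    exact hl this
  · have h1 := hms.2 T hT
    have h2 := (Equiv.neg ℝ).summable_iff.2 h1
    refine (h1.add h2).of_nonneg_of_le (fun l => indicator_nonneg (fun _ _ => norm_nonneg _) _)
      fun l => ?_
    simp only [Function.comp, Equiv.neg_apply, indicator, mem_Icc, neg_le_neg_iff]
    by_cases h : -T ≤ l ∧ l ≤ T
    · rw [if_pos h, if_pos h, if_pos (by constructor <;> linarith [h.1, h.2])]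
      exact hle l
    · rw [if_neg h, if_neg h, if_neg (fun h' => h (by constructor <;> linarith [h'.1, h'.2]))]
      simp

end Means

open scoped ComplexConjugate

lemma fstar_ofReal (E : ℂ → ℂ) (x : ℝ) : fstar E x = conj (E x) := by simp [fstar]

lemma HBA_ofReal (E : ℂ → ℂ) (x : ℝ) : HBA E x = ((E x).re : ℂ) := by
  rw [HBA, fstar_ofReal, add_comm, add_conj]; push_cast; ring

lemma HBB_ofReal (E : ℂ → ℂ) (x : ℝ) : HBB E x = ((-(E x).im : ℝ) : ℂ) := by
  have : conj (E x) - E x = -(E x - conj (E x)) := by ring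
  rw [HBB, fstar_ofReal, this, sub_conj]
  have := I_ne_zero
  push_cast; field_simp

lemma AnalyticAt.fstar {E : ℂ → ℂ} {x : ℝ} (h : AnalyticAt ℂ E x) :
    AnalyticAt ℂ (fstar E) x := by
  rw [Complex.analyticAt_iff_eventually_differentiableAt] at *
  have hc : Tendsto (fun z : ℂ => conj z) (𝓝 (x : ℂ)) (𝓝 (x : ℂ)) := by
    have := continuous_conj.tendsto (x : ℂ)
    rwa [conj_ofReal] at this
  filter_upwards [hc.eventually h] with z hz
  have := hz.conj_conj
  rwa [conj_conj] at this

lemma AnalyticAt.HBA {E : ℂ → ℂ} {x : ℝ} (h : AnalyticAt ℂ E x) : AnalyticAt ℂ (HBA E) x :=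
  (h.fstar.add h).div analyticAt_const two_ne_zero

lemma AnalyticAt.HBB {E : ℂ → ℂ} {x : ℝ} (h : AnalyticAt ℂ E x) : AnalyticAt ℂ (HBB E) x :=
  (h.fstar.sub h).div analyticAt_const (mul_ne_zero two_ne_zero I_ne_zero)

lemma analyticAt_dslope {g : ℂ → ℂ} {x : ℂ} (h : AnalyticAt ℂ g x) :
    AnalyticAt ℂ (dslope g x) x := by
  rw [Complex.analyticAt_iff_eventually_differentiableAt] at h
  obtain ⟨s, hs, ho, hx⟩ := eventually_nhds_iff.1 h
  have hn : s ∈ 𝓝 x := ho.mem_nhds hx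
  exact ((Complex.differentiableOn_dslope hn).2
    fun z hz => (hs z hz).differentiableWithinAt).analyticAt hn

instance nhdsWithin_UHP_neBot (x : ℝ) : (𝓝[UHP] (x : ℂ)).NeBot := by
  rw [← mem_closure_iff_nhdsWithin_neBot]
  have hlim : Tendsto (fun y : ℝ => (x : ℂ) + y * I) (𝓝[>] 0) (𝓝 x) := by
    have : Continuous fun y : ℝ => (x : ℂ) + y * I := by fun_prop
    have := this.tendsto 0
    simp only [ofReal_zero, zero_mul, add_zero] at this
    exact this.mono_left nhdsWithin_le_nhds
  refine mem_closure_of_tendsto hlim ?_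
  filter_upwards [self_mem_nhdsWithin] with y hy
  simpa [UHP] using hy

lemma HB.ne_zero {E : ℂ → ℂ} (hE : HB E) {z : ℂ} (hz : z ∈ UHP) : E z ≠ 0 := by
  intro h
  have := hE.2 z hz
  rw [h, norm_zero] at this
  exact absurd this (not_lt.2 (norm_nonneg _))

lemma HB.HBB_ne_zero {E : ℂ → ℂ} (hE : HB E) {z : ℂ} (hz : z ∈ UHP) : HBB E z ≠ 0 := by
  intro h
  rw [HBB, div_eq_zero_iff] at h
  rcases h with h | h
  · have := hE.2 z hz
    rw [sub_eq_zero.1 h] at this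
    exact lt_irrefl _ this
  · exact mul_ne_zero two_ne_zero I_ne_zero h

lemma HB.re_nonneg {E : ℂ → ℂ} (hE : HB E) {z : ℂ} (hz : z ∈ UHP) :
    0 ≤ (I * HBA E z / HBB E z).re := by
  have hne : E z - fstar E z ≠ 0 := by
    intro h
    apply hE.HBB_ne_zero hz
    rw [HBB, show fstar E z - E z = -(E z - fstar E z) by ring, h]; simp
  have hne' : fstar E z - E z ≠ 0 := by rw [← neg_sub]; exact neg_ne_zero.2 hne
  have e : I * HBA E z / HBB E z = (E z + fstar E z) / (E z - fstar E z) := by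
    rw [HBA, HBB]
    have := I_ne_zero
    field_simp
    linear_combination (fstar E z + E z) * (E z - fstar E z) * I_sq
  have h1 := hE.2 z hz
  rw [e, div_re, ← add_div]
  refine div_nonneg ?_ (normSq_nonneg _)
  have h2 : normSq (fstar E z) ≤ normSq (E z) := by
    rw [normSq_eq_norm_sq, normSq_eq_norm_sq]
    gcongr
  rw [normSq_apply, normSq_apply] at h2
  simp only [add_re, sub_re, add_im, sub_im]
  nlinarith

/-- The weight of a point in the measure attached to a phase function. -/
def phaseWeight (φ φd : ℝ → ℝ) (x : ℝ) : ℝ := (phaseZeros φ).indicator (fun x => 1 / φd x) x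

lemma im_eq_zero_of_hasDerivAt {q : ℂ → ℂ} {q' : ℂ} {x : ℝ} (hq : HasDerivAt q q' x)
    (hr : ∀ᶠ t : ℝ in 𝓝 x, (q t).im = 0) : q'.im = 0 := by
  have h1 : HasDerivAt (fun t : ℝ => q t) q' x := hq.comp_ofReal
  have h2 : HasDerivAt (fun t : ℝ => (q t).im) q'.im x :=
    imCLM.hasFDerivAt.comp_hasDerivAt x h1
  have h3 : HasDerivAt (fun t : ℝ => (q t).im) 0 x :=
    (hasDerivAt_const x (0 : ℝ)).congr_of_eventuallyEq hr
  exact h2.unique h3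

/-- Local form at a point of the real axis. -/
lemma tendsto_re_of_local {f Q : ℂ → ℂ} {x c : ℝ} {r : ℂ} (hr : r.im = 0)
    (hQ : Tendsto Q (𝓝[UHP] (x : ℂ)) (𝓝 r))
    (h : ∀ᶠ z in 𝓝[UHP] (x : ℂ), f z - I * c / (z - x) = I * Q z) :
    Tendsto (fun z => (f z - I * c / (z - x)).re) (𝓝[UHP] (x : ℂ)) (𝓝 0) := by
  have h1 : Tendsto (fun z => (I * Q z).re) (𝓝[UHP] (x : ℂ)) (𝓝 (I * r).re) :=
    (continuous_re.tendsto _).comp (hQ.const_mul I)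
  have h2 : (I * r).re = 0 := by simp [hr]
  rw [h2] at h1
  exact h1.congr' (h.mono fun z hz => by simp only [hz])

theorem HB.tendsto_re_sub_pole {E : ℂ → ℂ} (hE : HB E) {φ φd : ℝ → ℝ} (hφ : IsPhaseFor φ φd E)
    (x : ℝ) :
    Tendsto (fun z => (I * HBA E z / HBB E z - I * phaseWeight φ φd x / (z - x)).re)
      (𝓝[UHP] (x : ℂ)) (𝓝 0) := by
  have hEa : AnalyticAt ℂ E x := hE.1.analyticAt _
  have hE0 : ¬ ∀ᶠ z in 𝓝 (x : ℂ), E z = 0 := by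
    intro h
    obtain ⟨z, hz, hz'⟩ := ((h.filter_mono nhdsWithin_le_nhds).and
      (self_mem_nhdsWithin : ∀ᶠ z in 𝓝[UHP] (x : ℂ), z ∈ UHP)).exists
    exact hE.ne_zero hz' hz
  obtain ⟨k, G, hG, hG0, hEG⟩ := hEa.exists_eventuallyEq_pow_smul_nonzero_iff.2 hE0
  simp only [smul_eq_mul] at hEG
  have hconj : Tendsto (fun z : ℂ => conj z) (𝓝 (x : ℂ)) (𝓝 (x : ℂ)) := by
    have := continuous_conj.tendsto (x : ℂ)
    rwa [conj_ofReal] at this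
  have hEG' : ∀ᶠ z in 𝓝 (x : ℂ), fstar E z = (z - x) ^ k * fstar G z := by
    filter_upwards [hconj.eventually hEG] with z hz
    simp [fstar, hz]
  have hA : ∀ᶠ z in 𝓝 (x : ℂ), HBA E z = (z - x) ^ k * HBA G z := by
    filter_upwards [hEG, hEG'] with z h1 h2
    rw [HBA, HBA, h1, h2]; ring
  have hB : ∀ᶠ z in 𝓝 (x : ℂ), HBB E z = (z - x) ^ k * HBB G z := by
    filter_upwards [hEG, hEG'] with z h1 h2
    rw [HBB, HBB, h1, h2]; ring
  have hzx : ∀ z ∈ UHP, z - x ≠ 0 := fun z hz h => by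
    have : z = x := sub_eq_zero.1 h
    rw [this] at hz
    simp [UHP] at hz
  have hf : ∀ᶠ z in 𝓝[UHP] (x : ℂ), I * HBA E z / HBB E z = I * (HBA G z / HBB G z) ∧
      HBB G z ≠ 0 := by
    filter_upwards [hA.filter_mono nhdsWithin_le_nhds, hB.filter_mono nhdsWithin_le_nhds,
      self_mem_nhdsWithin] with z h1 h2 hz
    have h3 := hE.HBB_ne_zero hz
    rw [h2] at h3
    have h4 := right_ne_zero_of_mul h3
    have h5 := left_ne_zero_of_mul h3
    refine ⟨?_, h4⟩
    rw [h1, h2, mul_div_assoc, mul_div_mul_left _ _ h5]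
  -- the phase equation for the reduced function
  have hofReal : Tendsto (fun t : ℝ => (t : ℂ)) (𝓝 x) (𝓝 (x : ℂ)) := continuous_ofReal.tendsto x
  have hph_ne : ∀ᶠ t : ℝ in 𝓝[≠] x, (cexp (I * φ t) * G t).im = 0 := by
    filter_upwards [(hofReal.eventually hEG).filter_mono nhdsWithin_le_nhds,
      self_mem_nhdsWithin] with t ht htx
    have h1 := hφ.2.2 t
    have h2 : cexp (I * φ t) * ((t - x : ℂ) ^ k * G t) =
      (((t - x) ^ k : ℝ) : ℂ) * (cexp (I * φ t) * G t) := by push_cast; ring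
    rw [ht, h2, im_ofReal_mul, mul_eq_zero] at h1
    exact h1.resolve_left (pow_ne_zero _ (sub_ne_zero.2 htx))
  have hphc : ContinuousAt (fun t : ℝ => (cexp (I * φ t) * G t).im) x := by
    refine continuous_im.continuousAt.comp (ContinuousAt.mul ?_ ?_)
    · exact continuous_exp.continuousAt.comp (continuousAt_const.mul
        (continuous_ofReal.continuousAt.comp (hφ.1 x).continuousAt))
    · exact ContinuousAt.comp (f := fun t : ℝ => (t : ℂ)) hG.continuousAt hofReal
  have hph : ∀ᶠ t : ℝ in 𝓝 x, (cexp (I * φ t) * G t).im = 0 := by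
    have h0 : (cexp (I * φ x) * G x).im = 0 :=
      tendsto_nhds_unique (hphc.tendsto.mono_left nhdsWithin_le_nhds)
        (tendsto_const_nhds.congr' (hph_ne.mono fun t ht => ht.symm))
    rw [← nhdsNE_sup_pure, eventually_sup]
    exact ⟨hph_ne, by simpa using h0⟩
  have hphR : ∀ᶠ t : ℝ in 𝓝 x, (Real.cos (φ t) : ℂ) * HBB G t = Real.sin (φ t) * HBA G t := by
    filter_upwards [hph] with t ht
    rw [HBA_ofReal, HBB_ofReal]
    rw [mul_comm I, exp_mul_I, ← ofReal_cos, ← ofReal_sin] at ht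
    simp only [mul_im, add_re, add_im, ofReal_re, ofReal_im, mul_re, I_re, I_im] at ht
    norm_cast
    linarith
  have hphx := hphR.self_of_nhds
  have hGx : G x = HBA G x - I * HBB G x := by
    rw [HBA, HBB]
    have := I_ne_zero
    field_simp; ring
  have hAa := hG.HBA
  have hBa := hG.HBB
  by_cases hBx : HBB G x = 0
  · have hAx : HBA G x ≠ 0 := by
      intro h; rw [h, hBx] at hGx; simp [hGx] at hG0
    have hsin : Real.sin (φ x) = 0 := by
      rw [hBx, mul_zero, zero_eq_mul] at hphx
      exact_mod_cast hphx.resolve_right hAx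
    have hcos : (Real.cos (φ x) : ℂ) ≠ 0 := by
      have := Real.sin_sq_add_cos_sq (φ x)
      intro h
      have h' : Real.cos (φ x) = 0 := by exact_mod_cast h
      rw [hsin, h'] at this; norm_num at this
    have hmem : x ∈ phaseZeros φ := by
      obtain ⟨n, hn⟩ := Real.sin_eq_zero_iff.1 hsin
      exact ⟨n, hn.symm⟩
    have hd1 := (((hφ.1 x).cos.ofReal_comp).mul hBa.differentiableAt.hasDerivAt.comp_ofReal)
    have hd2 := (((hφ.1 x).sin.ofReal_comp).mul hAa.differentiableAt.hasDerivAt.comp_ofReal)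
    have hd := (hd1.congr_of_eventuallyEq (hphR.mono fun t ht => ht.symm)).unique hd2
    have hB' : deriv (HBB G) x = φd x * HBA G x := by
      simp only [hBx, hsin, ofReal_mul, ofReal_zero, mul_zero, zero_mul, zero_add, add_zero] at hd
      apply mul_left_cancel₀ hcos
      linear_combination hd
    have hφd : (φd x : ℂ) ≠ 0 := by exact_mod_cast (hφ.2.1 x).ne'
    set D := dslope (HBB G) x with hD
    have hDa : AnalyticAt ℂ D x := analyticAt_dslope hBa
    have hDx : D x = φd x * HBA G x := by rw [hD, dslope_same, hB']
    have hDx0 : D x ≠ 0 := by rw [hDx]; exact mul_ne_zero hφd hAx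
    have hBD : ∀ z, HBB G z = (z - x) * D z := by
      intro z
      have := sub_smul_dslope (HBB G) (x : ℂ) z
      rw [hBx, sub_zero, smul_eq_mul] at this
      exact this.symm
    set q : ℂ → ℂ := fun z => HBA G z / D z with hq
    have hqa : AnalyticAt ℂ q x := hAa.div hDa hDx0
    have hqx : q x = (phaseWeight φ φd x : ℂ) := by
      simp only [hq, phaseWeight, indicator_of_mem hmem, hDx]
      push_cast; field_simp
    have hqreal : ∀ᶠ t : ℝ in 𝓝 x, (q t).im = 0 := by
      refine Eventually.of_forall fun t => ?_
      rcases eq_or_ne t x with rfl | hne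
      · rw [hqx, ofReal_im]
      · have hne' : (t : ℂ) - x ≠ 0 := by
          rw [← ofReal_sub]; exact_mod_cast sub_ne_zero.2 hne
        have : q t = HBA G t * (t - x) / HBB G t := by
          rw [hBD, hq]; field_simp
        rw [this, HBA_ofReal, HBB_ofReal, ← ofReal_sub, ← ofReal_mul, ← ofReal_div, ofReal_im]
    refine tendsto_re_of_local (Q := dslope q x) (r := deriv q x)
      (im_eq_zero_of_hasDerivAt hqa.differentiableAt.hasDerivAt hqreal) ?_ ?_
    · have := (analyticAt_dslope hqa).continuousAt.tendsto
      rw [dslope_same] at this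
      exact this.mono_left nhdsWithin_le_nhds
    · filter_upwards [hf, self_mem_nhdsWithin] with z hz hzU
      have h1 := hzx z hzU
      have h2 := sub_smul_dslope q (x : ℂ) z
      rw [smul_eq_mul, hqx] at h2
      have h3 : HBA G z / HBB G z = q z / (z - x) := by
        rw [hBD, hq]; rw [div_div, mul_comm]
      rw [hz.1, h3]
      apply mul_left_cancel₀ h1
      have : (z - x) * (I * (q z / (z - x)) - I * (phaseWeight φ φd x) / (z - x)) =
        I * (q z - phaseWeight φ φd x) := by field_simp
      rw [this, ← h2]; ring
  · have hmem : x ∉ phaseZeros φ := by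
      rintro ⟨n, hn⟩
      have hsin : Real.sin (φ x) = 0 := by rw [hn, Real.sin_int_mul_pi]
      have hcos : (Real.cos (φ x) : ℂ) ≠ 0 := by
        have := Real.sin_sq_add_cos_sq (φ x)
        intro h
        have h' : Real.cos (φ x) = 0 := by exact_mod_cast h
        rw [hsin, h'] at this; norm_num at this
      rw [hsin, ofReal_zero, zero_mul] at hphx
      exact hBx ((mul_eq_zero.1 hphx).resolve_left hcos)
    have hw : phaseWeight φ φd x = 0 := indicator_of_notMem hmem _
    refine tendsto_re_of_local (Q := fun z => HBA G z / HBB G z) (r := HBA G x / HBB G x) ?_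
      ((hAa.continuousAt.tendsto.div hBa.continuousAt.tendsto hBx).mono_left nhdsWithin_le_nhds) ?_
    · rw [HBA_ofReal, HBB_ofReal, ← ofReal_div, ofReal_im]
    · filter_upwards [hf] with z hz
      rw [hz.1, hw]; simp

lemma IsPhaseFor.strictMono {φ φd : ℝ → ℝ} {E : ℂ → ℂ} (hφ : IsPhaseFor φ φd E) :
    StrictMono φ :=
  strictMono_of_hasDerivAt_pos hφ.1 hφ.2.1

lemma IsPhaseFor.finite_phaseZeros {φ φd : ℝ → ℝ} {E : ℂ → ℂ} (hφ : IsPhaseFor φ φd E) (a b : ℝ) :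
    (phaseZeros φ ∩ Icc a b).Finite := by
  refine Finite.of_finite_image (f := φ) (((Set.finite_Icc ⌈φ a / Real.pi⌉ ⌊φ b / Real.pi⌋).image
    fun k : ℤ => k * Real.pi).subset ?_) hφ.strictMono.injective.injOn
  rintro _ ⟨x, ⟨⟨k, hk⟩, hx⟩, rfl⟩
  refine ⟨k, ⟨Int.ceil_le.2 ?_, Int.le_floor.2 ?_⟩, hk.symm⟩
  · rw [div_le_iff₀ Real.pi_pos, ← hk]; exact hφ.strictMono.monotone hx.1
  · rw [le_div_iff₀ Real.pi_pos, ← hk]; exact hφ.strictMono.monotone hx.2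

lemma IsPhaseFor.countable_phaseZeros {φ φd : ℝ → ℝ} {E : ℂ → ℂ} (hφ : IsPhaseFor φ φd E) :
    (phaseZeros φ).Countable := by
  refine ((countable_range fun k : ℤ => k * Real.pi).preimage hφ.strictMono.injective).mono ?_
  rintro x ⟨k, hk⟩
  exact ⟨k, hk.symm⟩

lemma APH.bdd_strip {f : ℂ → ℂ} (hf : APH f) {α β : ℝ} (hα : 0 < α) (hαβ : α ≤ β) :
    ∃ C, ∀ z : ℂ, α ≤ z.im → z.im ≤ β → ‖f z‖ ≤ C := by
  obtain ⟨τ, ⟨l, hl, h⟩, hτ⟩ := hf.2 (α / 2) (2 * β) 1 (by positivity) (by linarith) one_pos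
  obtain ⟨C, hC⟩ := ((isCompact_Icc (a := (0 : ℝ)) (b := l)).reProdIm
    (isCompact_Icc (a := α) (b := β))).exists_bound_of_continuousOn
    (hf.1.continuousOn.mono fun z hz => by
      have := (mem_reProdIm.1 hz).2.1
      exact lt_of_lt_of_le hα this)
  refine ⟨1 + C, fun z h1 h2 => ?_⟩
  obtain ⟨t, ht, h3, h4⟩ := h (-z.re)
  have h5 := hτ t ht z (by linarith) (by linarith)
  have h6 := hC (z + t) (mem_reProdIm.2 ⟨⟨by simp; linarith, by simp; linarith⟩,
    ⟨by simpa using h1, by simpa using h2⟩⟩)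
  have := norm_sub_norm_le (f z) (f (z + t))
  linarith

lemma norm_four_add_sq_ge {x t : ℝ} (ht0 : 0 ≤ t) (ht : t ≤ 1) :
    3 + x ^ 2 ≤ ‖(4 : ℂ) + ((x : ℂ) + t * I) ^ 2‖ := by
  have h : ((4 : ℂ) + ((x : ℂ) + t * I) ^ 2).re = 4 + x ^ 2 - t ^ 2 := by
    simp [sq]; ring
  refine le_trans ?_ (re_le_norm _)
  rw [h]; nlinarith

lemma integrable_inv_three_add_sq : Integrable fun x : ℝ => (3 + x ^ 2)⁻¹ := by
  refine integrable_inv_one_add_sq.mono' (by fun_prop (disch := intros; positivity))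
    (ae_of_all _ fun x => ?_)
  rw [Real.norm_of_nonneg (by positivity)]
  gcongr; norm_num

lemma integrable_inv_four_add_sq : Integrable fun x : ℝ => (4 + x ^ 2)⁻¹ := by
  refine integrable_inv_three_add_sq.mono' (by fun_prop (disch := intros; positivity))
    (ae_of_all _ fun x => ?_)
  rw [Real.norm_of_nonneg (by positivity)]
  gcongr; norm_num

lemma APH.integrable_re_mul_inv {f : ℂ → ℂ} (hf : APH f) {y : ℝ} (hy : 0 < y) :
    Integrable fun x : ℝ => (f ((x : ℂ) + y * I)).re * (4 + x ^ 2)⁻¹ := by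
  obtain ⟨C, hC⟩ := hf.bdd_strip (α := y) (β := y) hy le_rfl
  refine integrable_inv_four_add_sq.bdd_mul (c := C)
    (continuous_re.comp (hf.continuous_line hy)).aestronglyMeasurable (ae_of_all _ fun x => ?_)
  exact (abs_re_le_norm _).trans (hC _ (by simp) (by simp))

/-- Cauchy's theorem bounds the weighted integral of a function bounded on strips, uniformly
near the real axis. -/
lemma APH.exists_integral_le {f : ℂ → ℂ} (hf : APH f) :
    ∃ K, ∀ y ∈ Ioo (0 : ℝ) 1,
      ∫ x : ℝ, (f ((x : ℂ) + y * I)).re * (4 + x ^ 2)⁻¹ ≤ K := by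
  obtain ⟨M, hM⟩ := hf.bdd_strip (α := 1) (β := 2) one_pos one_le_two
  have hM0 : 0 ≤ M := (norm_nonneg _).trans (hM I (by simp) (by simp))
  refine ⟨M * ∫ x : ℝ, (3 + x ^ 2)⁻¹, fun y hy => ?_⟩
  obtain ⟨C, hC⟩ := hf.bdd_strip (α := y) (β := y + 1) hy.1 (by linarith)
  have hC0 : 0 ≤ C := (norm_nonneg _).trans (hC (y * I) (by simp) (by simp))
  let V : ℂ → ℂ := fun z => (4 + (z - y * I) ^ 2)⁻¹
  have hVle : ∀ x t : ℝ, 0 ≤ t → t ≤ 1 → ‖V (x + (y + t : ℝ) * I)‖ ≤ (3 + x ^ 2)⁻¹ := by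
    intro x t h0 h1
    have e : V (x + (y + t : ℝ) * I) = ((4 : ℂ) + ((x : ℂ) + t * I) ^ 2)⁻¹ := by
      simp only [V]; congr 3; push_cast; ring
    rw [e, norm_inv]
    exact inv_anti₀ (by positivity) (norm_four_add_sq_ge h0 h1)
  have hV0 : ∀ x : ℝ, V (x + y * I) = (((4 + x ^ 2)⁻¹ : ℝ) : ℂ) := by
    intro x; simp only [V]; push_cast; congr 2; ring
  have hcauchy : ∀ T > (0 : ℝ), ‖∫ x in (-T)..T, f (x + y * I) * V (x + y * I)‖ ≤
      M * (∫ x : ℝ, (3 + x ^ 2)⁻¹) + 2 * C * (3 + T ^ 2)⁻¹ := by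
    intro T hT
    have hTT : -T ≤ T := by linarith
    have hrect := integral_boundary_rect_eq_zero_of_differentiableOn (fun z => f z * V z)
      (-T + y * I) (T + (y + 1 : ℝ) * I) (by
        intro z hz
        rw [mem_reProdIm] at hz
        have hzi := hz.2
        simp only [add_im, neg_im, ofReal_im, mul_im, ofReal_re, I_im, mul_one, I_re, mul_zero,
          add_zero, neg_zero, zero_add] at hzi
        rw [uIcc_of_le (by linarith)] at hzi
        have hzU : z ∈ UHP := lt_of_lt_of_le hy.1 hzi.1
        have ho : IsOpen UHP := isOpen_lt continuous_const continuous_im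
        refine ((hf.1.differentiableAt (ho.mem_nhds hzU)).mul ?_).differentiableWithinAt
        refine DifferentiableAt.inv (by fun_prop) fun h0 => ?_
        have := norm_four_add_sq_ge (x := z.re) (t := z.im - y) (by linarith [hzi.1])
          (by linarith [hzi.2])
        rw [show ((z.re : ℂ) + ((z.im - y : ℝ) : ℂ) * I) = z - y * I by
          conv_rhs => rw [← re_add_im z]
          push_cast; ring, h0, norm_zero] at this
        nlinarith [sq_nonneg z.re])
    simp only [add_im, neg_im, ofReal_im, mul_im, ofReal_re, I_im, mul_one, I_re, mul_zero,
          add_zero, neg_zero, zero_add, add_re, neg_re, mul_re, sub_self] at hrect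
    have htop : ‖∫ x in (-T)..T, f (x + (y + 1 : ℝ) * I) * V (x + (y + 1 : ℝ) * I)‖ ≤
        M * (∫ x : ℝ, (3 + x ^ 2)⁻¹) := by
      rw [intervalIntegral.integral_of_le hTT, ← integral_const_mul]
      refine (norm_integral_le_of_norm_le (g := fun x : ℝ => M * (3 + x ^ 2)⁻¹)
        (integrable_inv_three_add_sq.const_mul M).integrableOn (ae_of_all _ fun x => ?_)).trans
        (setIntegral_le_integral (integrable_inv_three_add_sq.const_mul M)
          (ae_of_all _ fun x => by positivity))
      rw [norm_mul]
      refine mul_le_mul (hM _ ?_ ?_) (hVle x 1 zero_le_one le_rfl) (norm_nonneg _) hM0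
      · simp; linarith [hy.1]
      · simp; linarith [hy.2]
    have hside : ∀ S : ℝ, ‖∫ t in y..(y + 1), f (S + t * I) * V (S + t * I)‖ ≤
        C * (3 + S ^ 2)⁻¹ := by
      intro S
      have := intervalIntegral.norm_integral_le_of_norm_le_const (a := y) (b := y + 1)
        (f := fun t : ℝ => f (S + t * I) * V (S + t * I)) (C := C * (3 + S ^ 2)⁻¹) (by
          intro t ht
          rw [uIoc_of_le (by linarith)] at ht
          rw [norm_mul]
          have hv := hVle S (t - y) (by linarith [ht.1]) (by linarith [ht.2])
          rw [add_sub_cancel] at hv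
          refine mul_le_mul (hC _ ?_ ?_) hv (norm_nonneg _) hC0
          · simp; linarith [ht.1]
          · simp; linarith [ht.2])
      simpa using this
    have h1 := hside T
    have h2 := hside (-T)
    rw [neg_sq] at h2
    push_cast at h1 h2 htop hrect
    set J1 := ∫ x in (-T)..T, f (x + y * I) * V (x + y * I)
    set J2 := ∫ x in (-T)..T, f (x + (y + 1) * I) * V (x + (y + 1) * I)
    set J3 := ∫ t in y..(y + 1), f (T + t * I) * V (T + t * I)
    set J4 := ∫ t in y..(y + 1), f (-T + t * I) * V (-T + t * I)
    have e : J1 = J2 - (I * J3 - I * J4) := by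
      simp only [smul_eq_mul] at hrect
      linear_combination hrect
    rw [e]
    refine (norm_sub_le _ _).trans ?_
    have h3 := norm_sub_le (I * J3) (I * J4)
    rw [norm_mul, norm_mul, norm_I, one_mul, one_mul] at h3
    linarith
  have hline : Continuous fun x : ℝ => f ((x : ℂ) + y * I) := hf.continuous_line hy.1
  have hint := hf.integrable_re_mul_inv hy.1
  have hlim := intervalIntegral_tendsto_integral hint tendsto_neg_atTop_atBot tendsto_id
  have hlim2 : Tendsto (fun T : ℝ => M * (∫ x : ℝ, (3 + x ^ 2)⁻¹) + 2 * C * (3 + T ^ 2)⁻¹) atTop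
      (𝓝 (M * (∫ x : ℝ, (3 + x ^ 2)⁻¹) + 2 * C * 0)) := by
    refine tendsto_const_nhds.add (Tendsto.const_mul _ (tendsto_inv_atTop_zero.comp ?_))
    exact tendsto_atTop_add_const_left _ _ (tendsto_pow_atTop two_ne_zero)
  rw [mul_zero, add_zero] at hlim2
  refine le_of_tendsto_of_tendsto hlim hlim2 ?_
  filter_upwards [eventually_gt_atTop 0] with T hT
  refine le_trans ?_ (hcauchy T hT)
  refine le_trans (le_of_eq ?_) (re_le_norm _)
  simp_rw [hV0]
  rw [id, intervalIntegral.integral_of_le (by linarith), intervalIntegral.integral_of_le (by linarith),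
    ← RCLike.re_eq_complex_re, ← integral_re]
  · refine integral_congr_ae (ae_of_all _ fun x => ?_)
    simp only [RCLike.re_eq_complex_re, re_mul_ofReal]
  · refine Integrable.mono' (g := fun _ => C * 1) (integrable_const _) ?_ (ae_of_all _ fun x => ?_)
    · refine Continuous.aestronglyMeasurable (hline.mul (continuous_ofReal.comp ?_))
      fun_prop (disch := intros; positivity)
    · rw [norm_mul, norm_real, Real.norm_of_nonneg (by positivity)]
      refine mul_le_mul (hC _ (by simp) (by simp)) ?_ (by positivity) hC0
      refine inv_le_one_of_one_le₀ ?_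
      nlinarith [sq_nonneg x]

lemma re_I_mul_div (c u y : ℝ) :
    (I * c / ((u : ℂ) + y * I)).re = c * (y / (u ^ 2 + y ^ 2)) := by
  rw [div_re]
  simp [normSq_apply]
  ring

/-- The Poisson kernel of the half-plane is an approximate identity. -/
lemma tendsto_integral_mul_poisson {Ψ : ℝ → ℂ} (hΨ : Continuous Ψ) {M : ℝ} (hM : ∀ x, ‖Ψ x‖ ≤ M)
    (γ : ℝ) :
    Tendsto (fun y : ℝ => ∫ x : ℝ, Ψ x * ((y / ((x - γ) ^ 2 + y ^ 2) : ℝ) : ℂ)) (𝓝[>] 0)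
      (𝓝 (Real.pi * Ψ γ)) := by
  have hM0 : 0 ≤ M := (norm_nonneg _).trans (hM 0)
  have h1 : Tendsto (fun y : ℝ => ∫ s : ℝ, Ψ (γ + y * s) * (((1 + s ^ 2)⁻¹ : ℝ) : ℂ)) (𝓝[>] 0)
      (𝓝 (∫ s : ℝ, Ψ γ * (((1 + s ^ 2)⁻¹ : ℝ) : ℂ))) := by
    refine tendsto_integral_filter_of_dominated_convergence (fun s => M * (1 + s ^ 2)⁻¹)
      (Eventually.of_forall fun y => ?_) (Eventually.of_forall fun y => ae_of_all _ fun s => ?_)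
      (integrable_inv_one_add_sq.const_mul M) (ae_of_all _ fun s => ?_)
    · refine Continuous.aestronglyMeasurable ((hΨ.comp (by fun_prop)).mul
        (continuous_ofReal.comp ?_))
      fun_prop (disch := intros; positivity)
    · rw [norm_mul, norm_real, Real.norm_of_nonneg (by positivity)]
      exact mul_le_mul_of_nonneg_right (hM _) (by positivity)
    · refine Tendsto.mul_const _ ((hΨ.tendsto γ).comp ?_)
      have : Tendsto (fun y : ℝ => γ + y * s) (𝓝 0) (𝓝 (γ + 0 * s)) :=
        (Continuous.tendsto (by fun_prop) _)
      simpa using this.mono_left nhdsWithin_le_nhds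
  rw [integral_const_mul, integral_complex_ofReal, integral_univ_inv_one_add_sq, mul_comm] at h1
  refine h1.congr' ?_
  filter_upwards [self_mem_nhdsWithin] with y (hy : 0 < y)
  rw [← integral_add_left_eq_self (fun x : ℝ => Ψ x * ((y / ((x - γ) ^ 2 + y ^ 2) : ℝ) : ℂ)) γ]
  have := Measure.integral_comp_mul_left
    (fun x : ℝ => Ψ (γ + x) * ((y / ((γ + x - γ) ^ 2 + y ^ 2) : ℝ) : ℂ)) y
  rw [eq_comm, inv_eq_one_div, abs_of_pos (by positivity), ← inv_eq_one_div,
    inv_smul_eq_iff₀ hy.ne', ← integral_smul] at this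
  rw [this]
  refine integral_congr_ae (ae_of_all _ fun s => ?_)
  simp only [real_smul]
  rw [mul_left_comm, ← ofReal_mul]
  congr 2
  field_simp
  ring

/-- `f` has real part vanishing on the real axis, except for simple poles with residue `I * c x`
at the points `x` of a locally finite set. -/
structure BoundaryPoles (f : ℂ → ℂ) (c : ℝ → ℝ) : Prop where
  nonneg : ∀ x, 0 ≤ c x
  finite : ∀ R : ℝ, (Function.support c ∩ Icc (-R) R).Finite
  tendsto : ∀ x : ℝ, Tendsto (fun z => (f z - I * c x / (z - x)).re) (𝓝[UHP] (x : ℂ)) (𝓝 0)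

lemma BoundaryPoles.tendsto_sub_sum {f : ℂ → ℂ} {c : ℝ → ℝ} (hc : BoundaryPoles f c)
    {F : Finset ℝ} {x : ℝ} (hx : x ∈ F ∨ c x = 0) :
    Tendsto (fun z => (f z - ∑ γ ∈ F, I * c γ / (z - γ)).re) (𝓝[UHP] (x : ℂ)) (𝓝 0) := by
  have h1 : ∀ γ ∈ F.erase x, Tendsto (fun z : ℂ => (I * c γ / (z - γ)).re) (𝓝[UHP] (x : ℂ))
      (𝓝 0) := by
    intro γ hγ
    have hne : (x : ℂ) - γ ≠ 0 := sub_ne_zero.2 fun h => (Finset.ne_of_mem_erase hγ)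
      (ofReal_injective h).symm
    have h0 : (I * c γ / ((x : ℂ) - γ)).re = 0 := by
      have := re_I_mul_div (c γ) (x - γ) 0
      simpa using this
    rw [← h0]
    refine Tendsto.mono_left ?_ nhdsWithin_le_nhds
    refine ContinuousAt.tendsto (f := fun z : ℂ => (I * c γ / (z - γ)).re) ?_
    fun_prop (disch := exact hne)
  have h2 := (hc.tendsto x).sub (tendsto_finsetSum _ h1)
  rw [Finset.sum_const_zero, sub_zero] at h2
  refine h2.congr fun z => ?_
  rw [← re_sum, ← sub_re]
  congr 1
  rcases hx with hx | hx
  · rw [← Finset.add_sum_erase _ _ hx]; ring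
  · rw [hx, Finset.sum_erase _ (by simp [hx])]; simp

lemma tendsto_add_mul_I_nhdsWithin_UHP (x : ℝ) (s : Set ℝ) :
    Tendsto (fun p : ℝ × ℝ => (p.2 : ℂ) + p.1 * I) (𝓝[>] 0 ×ˢ 𝓝[s] x) (𝓝[UHP] (x : ℂ)) := by
  refine tendsto_nhdsWithin_iff.2 ⟨?_, ?_⟩
  · have : Tendsto (fun p : ℝ × ℝ => (p.2 : ℂ) + p.1 * I) (𝓝 ((0 : ℝ), x))
        (𝓝 ((x : ℂ) + (0 : ℝ) * I)) := Continuous.tendsto (by fun_prop) _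
    rw [ofReal_zero, zero_mul, add_zero, nhds_prod_eq] at this
    exact this.mono_left (prod_mono nhdsWithin_le_nhds nhdsWithin_le_nhds)
  · have : ∀ᶠ p : ℝ × ℝ in 𝓝[>] 0 ×ˢ 𝓝[s] x, 0 < p.1 :=
      tendsto_fst.eventually self_mem_nhdsWithin
    filter_upwards [this] with p hp
    simpa [UHP] using hp

/-- The real parts on horizontal lines converge weakly to the point masses at the poles. -/
lemma BoundaryPoles.tendsto_integral {f : ℂ → ℂ} {c : ℝ → ℝ} (hc : BoundaryPoles f c)
    (hf : APH f) {Ψ : ℝ → ℂ} (hΨ : Continuous Ψ) {R : ℝ} (hR : ∀ x ∉ Icc (-R) R, Ψ x = 0) :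
    Tendsto (fun y : ℝ => ∫ x : ℝ, Ψ x * ((f ((x : ℂ) + y * I)).re : ℂ)) (𝓝[>] 0)
      (𝓝 (Real.pi * ∑ γ ∈ (hc.finite R).toFinset, c γ * Ψ γ)) := by
  set F := (hc.finite R).toFinset with hF
  have hΨs : HasCompactSupport Ψ := HasCompactSupport.intro isCompact_Icc hR
  have hΨi : Integrable Ψ := hΨ.integrable_of_hasCompactSupport hΨs
  obtain ⟨M, hM⟩ := hΨs.exists_bound_of_continuous hΨ
  let h : ℝ → ℝ → ℝ := fun y x =>
    (f ((x : ℂ) + y * I) - ∑ γ ∈ F, I * c γ / ((x : ℂ) + y * I - γ)).re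
  have hunif : TendstoUniformlyOn h 0 (𝓝[>] 0) (Icc (-R) R) := by
    rw [← tendstoLocallyUniformlyOn_iff_tendstoUniformlyOn_of_compact isCompact_Icc,
      tendstoLocallyUniformlyOn_iff_forall_tendsto]
    intro x hx
    have hx' : x ∈ F ∨ c x = 0 := by
      by_cases h0 : c x = 0
      · exact Or.inr h0
      · exact Or.inl ((hc.finite R).mem_toFinset.2 ⟨h0, hx⟩)
    have := (hc.tendsto_sub_sum hx').comp (tendsto_add_mul_I_nhdsWithin_UHP x (Icc (-R) R))
    rw [tendsto_uniformity_iff_dist_tendsto_zero]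
    simpa only [Pi.zero_apply, dist_zero_left, norm_zero, h, Function.comp_def] using this.norm
  have hcont : ∀ y : ℝ, 0 < y → Continuous fun x : ℝ => f ((x : ℂ) + y * I) :=
    fun y hy => hf.continuous_line hy
  have hne : ∀ (x γ : ℝ) (y : ℝ), 0 < y → (x : ℂ) + y * I - γ ≠ 0 := by
    intro x γ y hy h0
    have := congrArg im h0
    simp at this
    exact hy.ne' this
  have hcs : ∀ y : ℝ, 0 < y → ∀ γ, Continuous fun x : ℝ => I * c γ / ((x : ℂ) + y * I - γ) := by
    intro y hy γ
    have := fun x => hne x γ y hy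
    fun_prop (disch := exact this)
  have hch : ∀ y : ℝ, 0 < y → Continuous (h y) := by
    intro y hy
    exact continuous_re.comp ((hcont y hy).sub (continuous_finsetSum _ fun γ _ => hcs y hy γ))
  have h1 : Tendsto (fun y : ℝ => ∫ x : ℝ, Ψ x * (h y x : ℂ)) (𝓝[>] 0) (𝓝 0) := by
    rw [Metric.tendsto_nhds]
    intro ε hε
    set N := ∫ x, ‖Ψ x‖
    have hN : 0 ≤ N := integral_nonneg fun _ => norm_nonneg _
    filter_upwards [Metric.tendstoUniformlyOn_iff.1 hunif (ε / (N + 1)) (by positivity)] with y hy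
    rw [dist_zero_right]
    have hb : ‖∫ x : ℝ, Ψ x * (h y x : ℂ)‖ ≤ ∫ x, ‖Ψ x‖ * (ε / (N + 1)) := by
      refine norm_integral_le_of_norm_le (hΨi.norm.mul_const _) (ae_of_all _ fun x => ?_)
      rw [norm_mul, norm_real]
      by_cases hx : x ∈ Icc (-R) R
      · have := hy x hx
        simp only [Pi.zero_apply, dist_zero_left] at this
        gcongr
      · simp [hR x hx]
    refine hb.trans_lt ?_
    rw [integral_mul_const, mul_div_assoc', div_lt_iff₀ (by positivity)]
    change N * ε < ε * (N + 1)
    nlinarith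
  have h2 : Tendsto (fun y : ℝ => ∑ γ ∈ F, c γ *
      ∫ x : ℝ, Ψ x * ((y / ((x - γ) ^ 2 + y ^ 2) : ℝ) : ℂ)) (𝓝[>] 0)
      (𝓝 (∑ γ ∈ F, c γ * (Real.pi * Ψ γ))) :=
    tendsto_finsetSum _ fun γ _ => (tendsto_integral_mul_poisson hΨ hM γ).const_mul _
  have h3 := h1.add h2
  rw [zero_add] at h3
  rw [Finset.mul_sum]
  simp only [mul_left_comm (Real.pi : ℂ)]
  refine h3.congr' ?_
  filter_upwards [self_mem_nhdsWithin] with y (hy : 0 < y)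
  have hint : ∀ {g : ℝ → ℝ}, Continuous g → Integrable fun x => Ψ x * (g x : ℂ) := fun {g} hg =>
    (hΨ.mul (continuous_ofReal.comp hg)).integrable_of_hasCompactSupport hΨs.mul_right
  simp only [← integral_const_mul]
  have hpk : ∀ x γ : ℝ, (I * c γ / ((x : ℂ) + y * I - γ)).re =
      c γ * (y / ((x - γ) ^ 2 + y ^ 2)) := by
    intro x γ
    rw [← re_I_mul_div]
    congr 2; push_cast; ring
  have hpc : ∀ γ, Continuous fun x : ℝ => c γ * (y / ((x - γ) ^ 2 + y ^ 2)) := by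
    intro γ
    simp only [← hpk]
    exact continuous_re.comp (hcs y hy γ)
  have hpi : ∀ γ ∈ F, Integrable fun x : ℝ =>
      (c γ : ℂ) * (Ψ x * ((y / ((x - γ) ^ 2 + y ^ 2) : ℝ) : ℂ)) := by
    intro γ _
    refine (hint (hpc γ)).congr (ae_of_all _ fun x => ?_)
    simp only; push_cast; ring
  rw [← integral_finsetSum _ hpi, ← integral_add (hint (hch y hy)) (integrable_finsetSum _ hpi)]
  refine integral_congr_ae (ae_of_all _ fun x => ?_)
  simp only [h, sub_re, re_sum, hpk]
  push_cast
  rw [mul_sub, Finset.mul_sum, sub_add, sub_eq_self, ← Finset.sum_sub_distrib]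
  exact Finset.sum_eq_zero fun γ _ => by ring

/-- The trapezoidal cutoff equal to `1` on `[-R, R]` and supported in `[-(R + 1), R + 1]`. -/
def trapezoid (R x : ℝ) : ℝ := max 0 (min 1 (R + 1 - |x|))

lemma continuous_trapezoid (R : ℝ) : Continuous (trapezoid R) := by
  unfold trapezoid; fun_prop

lemma trapezoid_nonneg (R x : ℝ) : 0 ≤ trapezoid R x := le_max_left _ _

lemma trapezoid_le_one (R x : ℝ) : trapezoid R x ≤ 1 := max_le zero_le_one (min_le_left _ _)

lemma trapezoid_eq_one {R x : ℝ} (h : |x| ≤ R) : trapezoid R x = 1 := by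
  rw [trapezoid, min_eq_left (by linarith), max_eq_right zero_le_one]

lemma trapezoid_eq_zero {R x : ℝ} (h : x ∉ Icc (-(R + 1)) (R + 1)) : trapezoid R x = 0 := by
  rw [mem_Icc, ← abs_le, not_le] at h
  exact max_eq_left (min_le_of_right_le (by linarith))

lemma BoundaryPoles.tendsto_integral_tsum {f : ℂ → ℂ} {c : ℝ → ℝ} (hc : BoundaryPoles f c)
    (hf : APH f) {Ψ : ℝ → ℂ} (hΨ : Continuous Ψ) {R : ℝ} (hR : ∀ x ∉ Icc (-R) R, Ψ x = 0) :
    Tendsto (fun y : ℝ => ∫ x : ℝ, Ψ x * ((f ((x : ℂ) + y * I)).re : ℂ)) (𝓝[>] 0)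
      (𝓝 (Real.pi * ∑' γ, c γ * Ψ γ)) := by
  rw [tsum_eq_sum (s := (hc.finite R).toFinset)]
  · exact hc.tendsto_integral hf hΨ hR
  · intro γ hγ
    rw [Finite.mem_toFinset, mem_inter_iff, not_and_or, Function.notMem_support] at hγ
    rcases hγ with h | h
    · simp [h]
    · simp [hR γ h]

lemma BoundaryPoles.summable {f : ℂ → ℂ} {c : ℝ → ℝ} (hc : BoundaryPoles f c)
    (hf : APH f) (hre : ∀ z ∈ UHP, 0 ≤ (f z).re) :
    Summable fun γ => c γ * (4 + γ ^ 2)⁻¹ := by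
  obtain ⟨K, hK⟩ := hf.exists_integral_le
  refine summable_of_sum_le (c := K / Real.pi) (fun γ => mul_nonneg (hc.nonneg γ) (by positivity))
    fun u => ?_
  set R := ∑ γ ∈ u, |γ|
  let Ψ : ℝ → ℝ := fun x => trapezoid R x * (4 + x ^ 2)⁻¹
  have hΨc : Continuous Ψ := (continuous_trapezoid R).mul (by fun_prop (disch := intros; positivity))
  have hΨ0 : ∀ x, 0 ≤ Ψ x := fun x => mul_nonneg (trapezoid_nonneg _ _) (by positivity)
  have hlim := hc.tendsto_integral hf (Ψ := fun x => (Ψ x : ℂ)) (R := R + 1)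
    (continuous_ofReal.comp hΨc) fun x hx => by simp [Ψ, trapezoid_eq_zero hx]
  have hlim' := (continuous_re.tendsto _).comp hlim
  have hle := le_of_tendsto hlim' (b := K) <| by
    filter_upwards [Ioo_mem_nhdsGT (zero_lt_one' ℝ)] with y hy
    refine le_trans ?_ (hK y hy)
    simp only [Function.comp_apply, ← ofReal_mul]
    rw [integral_complex_ofReal, ofReal_re]
    have hfy : ∀ x : ℝ, 0 ≤ (f ((x : ℂ) + y * I)).re := fun x => hre _ (by simpa [UHP] using hy.1)
    refine integral_mono_of_nonneg (ae_of_all _ fun x => mul_nonneg (hΨ0 x) (hfy x))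
      (hf.integrable_re_mul_inv hy.1) (ae_of_all _ fun x => ?_)
    simp only [mul_comm (f _).re]
    refine mul_le_mul_of_nonneg_right ?_ (hfy x)
    exact mul_le_of_le_one_left (by positivity) (trapezoid_le_one _ _)
  rw [le_div_iff₀' Real.pi_pos]
  refine le_trans ?_ hle
  simp only [← ofReal_mul, ← ofReal_sum, ofReal_re]
  refine mul_le_mul_of_nonneg_left ?_ Real.pi_pos.le
  have e : ∑ γ ∈ u, c γ * (4 + γ ^ 2)⁻¹ = ∑ γ ∈ u, c γ * Ψ γ := by
    refine Finset.sum_congr rfl fun γ hγ => ?_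
    simp only [Ψ]
    rw [trapezoid_eq_one (Finset.single_le_sum (f := fun γ => |γ|) (fun _ _ => abs_nonneg _) hγ),
      one_mul]
  rw [e, ← Finset.sum_filter_ne_zero]
  refine Finset.sum_le_sum_of_subset_of_nonneg (fun γ hγ => ?_)
    fun γ _ _ => mul_nonneg (hc.nonneg γ) (hΨ0 γ)
  rw [Finset.mem_filter] at hγ
  rw [Finite.mem_toFinset]
  refine ⟨left_ne_zero_of_mul hγ.2, ?_⟩
  by_contra h
  exact right_ne_zero_of_mul hγ.2 (by simp [Ψ, trapezoid_eq_zero h])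

lemma tendsto_inv_four_add_sq_atTop : Tendsto (fun R : ℝ => (4 + R ^ 2)⁻¹) atTop (𝓝 0) :=
  tendsto_inv_atTop_zero.comp (tendsto_atTop_add_const_left _ _ (tendsto_pow_atTop two_ne_zero))

lemma BoundaryPoles.tendsto_integral_of_decay {f : ℂ → ℂ} {c : ℝ → ℝ} (hc : BoundaryPoles f c)
    (hf : APH f) (hre : ∀ z ∈ UHP, 0 ≤ (f z).re) {ψ : ℝ → ℂ} (hψ : Continuous ψ) {C : ℝ}
    (hC : ∀ x, ‖ψ x‖ ≤ C * ((4 + x ^ 2)⁻¹) ^ 2) :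
    Tendsto (fun y : ℝ => ∫ x : ℝ, ψ x * ((f ((x : ℂ) + y * I)).re : ℂ)) (𝓝[>] 0)
      (𝓝 (Real.pi * ∑' γ, c γ * ψ γ)) := by
  obtain ⟨K, hK⟩ := hf.exists_integral_le
  have hC0 : 0 ≤ C := by
    have := (norm_nonneg _).trans (hC 0)
    norm_num at this
    linarith
  have htl : ∀ R x : ℝ, ‖((trapezoid R x : ℝ) : ℂ) * ψ x‖ ≤ ‖ψ x‖ := fun R x => by
    rw [norm_mul, norm_real, Real.norm_of_nonneg (trapezoid_nonneg _ _)]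
    exact mul_le_of_le_one_left (norm_nonneg _) (trapezoid_le_one _ _)
  have hC' : ∀ x, ‖ψ x‖ ≤ C * (4 + x ^ 2)⁻¹ := fun x => (hC x).trans <| by
    gcongr
    exact pow_le_of_le_one (by positivity) (inv_le_one_of_one_le₀ (by nlinarith [sq_nonneg x]))
      two_ne_zero
  have hdiff : ∀ R > 0, ∀ x, ‖ψ x - ((trapezoid R x : ℝ) : ℂ) * ψ x‖ ≤
      C * (4 + R ^ 2)⁻¹ * (4 + x ^ 2)⁻¹ := by
    intro R hR x
    by_cases h : |x| ≤ R
    · rw [trapezoid_eq_one h, ofReal_one, one_mul, sub_self, norm_zero]; positivity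
    · have hx : R ^ 2 ≤ x ^ 2 := by
        rw [← sq_abs x]; exact pow_le_pow_left₀ hR.le (not_le.1 h).le 2
      have e : ψ x - ((trapezoid R x : ℝ) : ℂ) * ψ x = ((1 - trapezoid R x : ℝ) : ℂ) * ψ x := by
        push_cast; ring
      rw [e, norm_mul, norm_real,
        Real.norm_of_nonneg (sub_nonneg.2 (trapezoid_le_one _ _))]
      refine (mul_le_of_le_one_left (norm_nonneg _)
        (by linarith [trapezoid_nonneg R x])).trans ((hC x).trans ?_)
      rw [sq, ← mul_assoc]
      gcongr
  have hsum := hc.summable hf hre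
  have h1 : ∀ R : ℝ, Tendsto (fun y : ℝ => ∫ x : ℝ, ((trapezoid R x : ℝ) : ℂ) * ψ x *
      ((f ((x : ℂ) + y * I)).re : ℂ)) (𝓝[>] 0)
      (𝓝 (Real.pi * ∑' γ, c γ * (((trapezoid R γ : ℝ) : ℂ) * ψ γ))) := fun R =>
    hc.tendsto_integral_tsum hf ((continuous_ofReal.comp (continuous_trapezoid R)).mul hψ)
      (R := R + 1) fun x hx => by simp [trapezoid_eq_zero hx]
  have h2 : Tendsto (fun R : ℝ => Real.pi * ∑' γ, c γ * (((trapezoid R γ : ℝ) : ℂ) * ψ γ)) atTop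
      (𝓝 (Real.pi * ∑' γ, c γ * ψ γ)) := by
    refine Tendsto.const_mul _ (tendsto_tsum_of_dominated_convergence
      (bound := fun γ => C * (c γ * (4 + γ ^ 2)⁻¹)) (hsum.mul_left C) (fun γ => ?_)
      (Eventually.of_forall fun R γ => ?_))
    · refine tendsto_const_nhds.congr' ?_
      filter_upwards [eventually_ge_atTop |γ|] with R hR
      rw [trapezoid_eq_one hR, ofReal_one, one_mul]
    · rw [norm_mul, norm_real, Real.norm_of_nonneg (hc.nonneg γ)]
      calc c γ * ‖((trapezoid R γ : ℝ) : ℂ) * ψ γ‖ ≤ c γ * (C * (4 + γ ^ 2)⁻¹) :=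
            mul_le_mul_of_nonneg_left ((htl R γ).trans (hC' γ)) (hc.nonneg γ)
        _ = _ := by ring
  refine TendstoUniformlyOnFilter.tendsto_of_eventually_tendsto
    (Metric.tendstoUniformlyOnFilter_iff.2 fun ε hε => ?_) (Eventually.of_forall h1) h2
  have h3 : Tendsto (fun R : ℝ => C * (4 + R ^ 2)⁻¹ * K) atTop (𝓝 (C * 0 * K)) :=
    (tendsto_inv_four_add_sq_atTop.const_mul C).mul_const K
  rw [mul_zero, zero_mul] at h3
  have h4 : ∀ᶠ R : ℝ in atTop, 0 < R ∧ C * (4 + R ^ 2)⁻¹ * K < ε :=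
    (eventually_gt_atTop 0).and (h3.eventually (gt_mem_nhds hε))
  filter_upwards [h4.prod_mk (Ioo_mem_nhdsGT (zero_lt_one' ℝ))] with p ⟨⟨hR, hpε⟩, hy⟩
  have hint := hf.integrable_re_mul_inv hy.1
  have hfc : Continuous fun x : ℝ => ((f ((x : ℂ) + p.2 * I)).re : ℂ) :=
    continuous_ofReal.comp (continuous_re.comp (hf.continuous_line hy.1))
  have hfy : ∀ x : ℝ, 0 ≤ (f ((x : ℂ) + p.2 * I)).re := fun x =>
    hre _ (by simpa [UHP] using hy.1)
  have hi : ∀ {g : ℝ → ℂ}, Continuous g → (∀ x, ‖g x‖ ≤ C * (4 + x ^ 2)⁻¹) →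
      Integrable fun x : ℝ => g x * ((f ((x : ℂ) + p.2 * I)).re : ℂ) := by
    intro g hg hgC
    refine (hint.const_mul C).mono' (hg.mul hfc).aestronglyMeasurable (ae_of_all _ fun x => ?_)
    rw [norm_mul, norm_real, Real.norm_of_nonneg (hfy x)]
    calc _ ≤ C * (4 + x ^ 2)⁻¹ * (f ((x : ℂ) + p.2 * I)).re :=
          mul_le_mul_of_nonneg_right (hgC x) (hfy x)
      _ = _ := by ring
  have hi' := hi (g := fun x => ((trapezoid p.1 x : ℝ) : ℂ) * ψ x)
    ((continuous_ofReal.comp (continuous_trapezoid p.1)).mul hψ)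
    fun x => (htl p.1 x).trans (hC' x)
  rw [dist_eq_norm, ← integral_sub (hi hψ hC') hi']
  refine lt_of_le_of_lt ?_ hpε
  refine (norm_integral_le_of_norm_le (hint.const_mul (C * (4 + p.1 ^ 2)⁻¹))
    (ae_of_all _ fun x => ?_)).trans ?_
  · rw [← sub_mul, norm_mul, norm_real, Real.norm_of_nonneg (hfy x)]
    calc _ ≤ C * (4 + p.1 ^ 2)⁻¹ * (4 + x ^ 2)⁻¹ * (f ((x : ℂ) + p.2 * I)).re :=
          mul_le_mul_of_nonneg_right (hdiff p.1 hR x) (hfy x)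
      _ = _ := by ring
  · rw [integral_const_mul]
    exact mul_le_mul_of_nonneg_left (hK p.2 hy) (by positivity)

lemma SchwartzMap.exists_norm_le_inv_four_add_sq (ψ : SchwartzMap ℝ ℂ) :
    ∃ C, ∀ x, ‖ψ x‖ ≤ C * ((4 + x ^ 2)⁻¹) ^ 2 := by
  obtain ⟨C, hC⟩ := ψ.decay 0 0
  obtain ⟨D, hD⟩ := ψ.decay 4 0
  refine ⟨32 * C + 2 * D, fun x => ?_⟩
  have h1 := hC.2 x
  have h2 := hD.2 x
  simp only [norm_iteratedFDeriv_zero, pow_zero, one_mul] at h1 h2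
  rw [inv_pow, ← div_eq_mul_inv, le_div_iff₀ (by positivity)]
  have h3 : (4 + x ^ 2) ^ 2 ≤ 32 + 2 * ‖x‖ ^ 4 := by
    rw [Real.norm_eq_abs, show |x| ^ 4 = (x ^ 2) ^ 2 by rw [← sq_abs x]; ring]
    nlinarith [sq_nonneg (x ^ 2 - 4)]
  nlinarith [norm_nonneg (ψ x), mul_le_mul_of_nonneg_left h3 (norm_nonneg (ψ x))]

lemma HB.boundaryPoles {E : ℂ → ℂ} (hE : HB E) {φ φd : ℝ → ℝ} (hφ : IsPhaseFor φ φd E) :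
    BoundaryPoles (fun z => I * HBA E z / HBB E z) (phaseWeight φ φd) where
  nonneg x := indicator_nonneg (fun x _ => one_div_nonneg.2 (hφ.2.1 x).le) x
  finite R := (hφ.finite_phaseZeros (-R) R).subset
    (inter_subset_inter_left _ support_indicator_subset)
  tendsto x := hE.tendsto_re_sub_pole hφ x

lemma APH.const_mul {f : ℂ → ℂ} (hf : APH f) {k : ℂ} (hk : ‖k‖ = 1) : APH fun z => k * f z := by
  refine ⟨hf.1.const_mul k, fun α β ε h1 h2 h3 => ?_⟩
  obtain ⟨τ, hτ, h⟩ := hf.2 α β ε h1 h2 h3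
  refine ⟨τ, hτ, fun t ht z hz hz' => ?_⟩
  rw [← mul_sub, norm_mul, hk, one_mul]
  exact h t ht z hz hz'

lemma IsPhaseFor.measSupport_subset {φ φd : ℝ → ℝ} {E : ℂ → ℂ} (hφ : IsPhaseFor φ φd E) :
    measSupport (phaseMeasure φ φd) ⊆ phaseZeros φ := by
  intro x hx
  by_contra hxZ
  have hfin := hφ.finite_phaseZeros (x - 1) (x + 1)
  have hU : Ioo (x - 1) (x + 1) \ (phaseZeros φ ∩ Icc (x - 1) (x + 1)) ∈ 𝓝 x :=
    (isOpen_Ioo.sdiff hfin.isClosed).mem_nhds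
      ⟨⟨by linarith, by linarith⟩, fun h => hxZ h.1⟩
  refine hx _ hU ?_
  rw [phaseMeasure, Measure.sum_apply _ (isOpen_Ioo.sdiff hfin.isClosed).measurableSet,
    ENNReal.tsum_eq_zero]
  intro γ
  rw [Measure.smul_apply, Measure.dirac_apply' _ (isOpen_Ioo.sdiff hfin.isClosed).measurableSet,
    indicator_of_notMem, smul_zero]
  exact fun h => h.2 ⟨γ.2, Ioo_subset_Icc_self h.1⟩

lemma phaseWeight_smul {φ φd : ℝ → ℝ} {E : ℂ → ℂ} (hφ : IsPhaseFor φ φd E) (ψ : ℝ → ℂ)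
    (γ : phaseZeros φ) : (ENNReal.ofReal (2 * Real.pi / φd γ)).toReal • ψ γ =
      2 * Real.pi * (phaseWeight φ φd γ * ψ γ) := by
  have h := hφ.2.1 (γ : ℝ)
  rw [ENNReal.toReal_ofReal (by positivity), phaseWeight, indicator_of_mem γ.2, real_smul]
  push_cast; ring

lemma IsPhaseFor.integral_phaseMeasure {φ φd : ℝ → ℝ} {E : ℂ → ℂ} (hφ : IsPhaseFor φ φd E)
    (ψ : ℝ → ℂ) :
    ∫ x, ψ x ∂phaseMeasure φ φd = 2 * Real.pi * ∑' γ, phaseWeight φ φd γ * ψ γ := by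
  have := hφ.countable_phaseZeros.to_subtype
  rw [phaseMeasure, integral_sum_dirac fun _ => ENNReal.ofReal_ne_top, ← tsum_mul_left]
  simp only [phaseWeight_smul hφ]
  refine tsum_subtype_eq_of_support_subset
    (f := fun γ => 2 * (Real.pi : ℂ) * (phaseWeight φ φd γ * ψ γ)) fun γ hγ => ?_
  by_contra h
  exact hγ (by simp [phaseWeight, indicator_of_notMem h])

lemma IsPhaseFor.integrable_phaseMeasure {φ φd : ℝ → ℝ} {E : ℂ → ℂ} (hφ : IsPhaseFor φ φd E)
    (hs : Summable fun γ => phaseWeight φ φd γ * (4 + γ ^ 2)⁻¹) (ψ : SchwartzMap ℝ ℂ) :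
    Integrable (fun x => ψ x) (phaseMeasure φ φd) := by
  have := hφ.countable_phaseZeros.to_subtype
  obtain ⟨C, hC⟩ := ψ.exists_norm_le_inv_four_add_sq
  refine integrable_sum_dirac (fun _ => ENNReal.ofReal_ne_top) ?_
  refine Summable.of_nonneg_of_le (fun γ => by positivity) (fun γ => ?_)
    ((hs.mul_left (2 * Real.pi * C)).subtype (phaseZeros φ))
  have h := hφ.2.1 (γ : ℝ)
  have hC0 : 0 ≤ C := by
    have := (norm_nonneg _).trans (hC 0)
    norm_num at this
    linarith
  have h1 : ‖ψ γ‖ ≤ C * (4 + (γ : ℝ) ^ 2)⁻¹ := (hC γ).trans <| by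
    gcongr
    exact pow_le_of_le_one (by positivity)
      (inv_le_one_of_one_le₀ (by nlinarith [sq_nonneg (γ : ℝ)])) two_ne_zero
  simp only [Function.comp_apply]
  rw [ENNReal.toReal_ofReal (by positivity), phaseWeight, indicator_of_mem γ.2]
  calc _ ≤ 2 * Real.pi / φd γ * (C * (4 + (γ : ℝ) ^ 2)⁻¹) := by gcongr
    _ = _ := by ring

lemma LocSummable.summable_mul {a φ : ℝ → ℂ} (ha : LocSummable a) (hφ : Continuous φ)
    (hs : HasCompactSupport φ) : Summable fun l => ‖a l‖ * ‖φ l‖ := by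
  obtain ⟨M, hM⟩ := hs.exists_bound_of_continuous hφ
  obtain ⟨R, hR⟩ := hs.isCompact.isBounded.subset_closedBall 0
  refine Summable.of_nonneg_of_le (fun l => by positivity) (fun l => ?_)
    ((ha.2 (max R 1) (by positivity)).mul_right M)
  by_cases h : l ∈ Icc (-(max R 1)) (max R 1)
  · rw [indicator_of_mem h]
    exact mul_le_mul_of_nonneg_left (hM l) (norm_nonneg _)
  · rw [image_eq_zero_of_notMem_tsupport (f := φ) (x := l) fun hl => h ?_, norm_zero, mul_zero,
      indicator_of_notMem h, zero_mul]
    have := hR hl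
    rw [mem_closedBall_zero_iff, Real.norm_eq_abs] at this
    exact abs_le.1 (this.trans (le_max_left _ _))

/-- Theorem (direct part of Thm 3.1): the Hermite–Biehler construction gives a
nonnegative real-antipodal FS-pair with locally finite support. -/
theorem stmt2 (E : ℂ → ℂ) (hE : HB E)
    (hAB : APH (fun z => HBA E z / HBB E z))
    (m : ℝ → ℂ)
    (hm : ∀ (lam : ℝ), ∀ y > (0:ℝ),
      HasMeanAt (fun z => Complex.I * HBA E z / HBB E z) y lam (m lam))
    (hms : LocSummable m)
    (a : ℝ → ℂ) (ha : ∀ lam > (0:ℝ), a lam = m lam)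
    (ha0 : a 0 = 2 * ((m 0).re : ℂ))
    (haneg : ∀ lam > (0:ℝ), a (-lam) = (starRingEnd ℂ) (a lam))
    (φ φd : ℝ → ℝ) (hφ : IsPhaseFor φ φd E)
    (μ : CMeasure) (hμν : μ.ν = phaseMeasure φ φd) (hμw : ∀ t, μ.w t = 1) :
    IsFSPair μ a ∧ μ.RealValued ∧ Antipodal a ∧ μ.Nonneg ∧
      LocFinSet (measSupport μ.ν) := by
  have hf : APH (fun z => I * HBA E z / HBB E z) := by
    simp only [mul_div_assoc]
    exact hAB.const_mul norm_I
  have hre : ∀ z ∈ UHP, 0 ≤ (I * HBA E z / HBB E z).re := fun z hz => hE.re_nonneg hz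
  have hbp := hE.boundaryPoles hφ
  have hla : LocSummable a := locSummable_of hms ha ha0 haneg
  refine ⟨⟨fun ψ => ?_, hla, fun θ hθ hθs => ?_⟩, ae_of_all _ fun t => by simp [hμw t],
    antipodal_of ha0 haneg, ae_of_all _ hμw, fun b d => ?_⟩
  · rw [hμν]
    exact hφ.integrable_phaseMeasure (hbp.summable hf hre) ψ
  · obtain ⟨ψ, hψ, -⟩ := exists_schwartz_FT hθ hθs
    obtain ⟨C, hC⟩ := ψ.exists_norm_le_inv_four_add_sq
    have hsum := hla.summable_mul hθ.continuous hθs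
    have hlhs := (hbp.tendsto_integral_of_decay hf hre ψ.continuous hC).const_mul (2 : ℂ)
    have hrhs : Tendsto (fun y : ℝ => ∑' l, a l * Real.exp (-(2 * Real.pi * |l| * y)) * θ l)
        (𝓝[>] 0) (𝓝 (∑' l, a l * θ l)) := by
      refine tendsto_tsum_of_dominated_convergence hsum (fun l => ?_) ?_
      · have : Tendsto (fun y : ℝ => a l * Real.exp (-(2 * Real.pi * |l| * y)) * θ l) (𝓝 0)
            (𝓝 (a l * Real.exp (-(2 * Real.pi * |l| * 0)) * θ l)) :=
          Continuous.tendsto (by fun_prop) _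
        simpa using this.mono_left nhdsWithin_le_nhds
      · filter_upwards [self_mem_nhdsWithin] with y (hy : 0 < y) l
        rw [norm_mul, norm_mul, norm_real, Real.norm_of_nonneg (Real.exp_pos _).le]
        refine mul_le_mul_of_nonneg_right (mul_le_of_le_one_right (norm_nonneg _) ?_)
          (norm_nonneg _)
        exact Real.exp_le_one_iff.2 (neg_nonpos.2 (by positivity))
    have heq : ∀ y : ℝ, 0 < y → 2 * ∫ x : ℝ, ψ x *
        ((I * HBA E ((x : ℂ) + y * I) / HBB E ((x : ℂ) + y * I)).re : ℂ) =
        ∑' l, a l * Real.exp (-(2 * Real.pi * |l| * y)) * θ l := by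
      intro y hy
      rw [← BohrAP.integral_FT_mul (hf.bohrAP_re hy)
        (fun l => hf.hasMeanR_re_eq hre hm ha ha0 haneg hy l) hθ hθs, ← integral_const_mul]
      · refine integral_congr_ae (ae_of_all _ fun x => ?_)
        simp only [← hψ]
        push_cast; ring
      · refine Summable.of_nonneg_of_le (fun l => norm_nonneg _) (fun l => ?_) hsum
        rw [norm_mul, norm_mul, norm_real, Real.norm_of_nonneg (Real.exp_pos _).le]
        refine mul_le_mul_of_nonneg_right (mul_le_of_le_one_right (norm_nonneg _) ?_)
          (norm_nonneg _)
        exact Real.exp_le_one_iff.2 (neg_nonpos.2 (by positivity))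
    have hlim := tendsto_nhds_unique (hlhs.congr' (by
      filter_upwards [self_mem_nhdsWithin] with y hy using heq y hy)) hrhs
    rw [← hlim, CMeasure.integral, hμν, ← mul_assoc, ← funext hψ]
    simp only [hμw, mul_one]
    exact hφ.integral_phaseMeasure ψ
  · rw [hμν]
    exact (hφ.finite_phaseZeros b d).subset
      (inter_subset_inter hφ.measSupport_subset Ioo_subset_Icc_self)
end
end

section
/- If (μ,a) is an FS-pair such that μ ≥ 0 and a has exponential growth, then there exists C > 0 such that ∫_ℝ dμ(t)/(C² + t²) < ∞; in particular deg(μ) ≤ 2. -/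
open MeasureTheory Complex Filter Topology Set
open scoped ENNReal

noncomputable section

/-- `FT` agrees with Mathlib's Fourier transform. -/
lemma FT_eq_fourier (φ : ℝ → ℂ) : FT φ = FourierTransform.fourier φ := by
  funext ξ
  rw [Real.fourier_real_eq_integral_exp_smul, FT]
  congr 1
  funext x
  rw [smul_eq_mul, mul_comm]
  congr 2
  push_cast
  ring

/-- The Fourier transform of a test function is integrable against a strongly tempered measure. -/
lemma CMeasure.IsStronglyTempered.integrable_FT {μ : CMeasure} (hμ : μ.IsStronglyTempered)
    {φ : ℝ → ℂ} (hφ : ContDiff ℝ (⊤ : ℕ∞) φ) (hc : HasCompactSupport φ) :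
    Integrable (FT φ) μ.ν := by
  rw [FT_eq_fourier]
  exact hμ (FourierTransform.fourier (hc.toSchwartzMap hφ))

/-- Scaling rule for the Fourier transform. -/
lemma FT_comp_mul_left (φ : ℝ → ℂ) {s : ℝ} (hs : 0 < s) (t : ℝ) :
    FT (fun x => φ (s * x)) t = (s : ℂ)⁻¹ * FT φ (t / s) := by
  have h := Measure.integral_comp_mul_left
    (fun x : ℝ => φ x * exp (-(2 * (Real.pi : ℂ) * I * (x : ℂ) * ((t / s : ℝ) : ℂ)))) s
  rw [abs_of_pos (inv_pos.2 hs), Complex.real_smul, Complex.ofReal_inv] at h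
  rw [FT, FT, ← h]
  congr 1
  funext x
  congr 2
  have : (s : ℂ) ≠ 0 := by exact_mod_cast hs.ne'
  push_cast
  field_simp

/-- There is a test function whose Fourier transform is nonnegative and positive at `0`. -/
lemma exists_testFunction_FT_nonneg :
    ∃ (φ : ℝ → ℂ) (g : ℝ → ℝ), ContDiff ℝ (⊤ : ℕ∞) φ ∧ HasCompactSupport φ ∧ Continuous g ∧
      (∀ t, 0 ≤ g t) ∧ 0 < g 0 ∧ ∀ t, FT φ t = g t := by
  let f : ContDiffBump (0 : ℝ) := ⟨1, 2, one_pos, one_lt_two⟩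
  let η : ℝ → ℂ := fun x => (f x : ℂ)
  have hηs : ContDiff ℝ (⊤ : ℕ∞) η := Complex.ofRealCLM.contDiff.comp f.contDiff
  have hηc : HasCompactSupport η := f.hasCompactSupport.comp_left Complex.ofReal_zero
  have hηi : Integrable η := hηs.continuous.integrable_of_hasCompactSupport hηc
  have hreal : ∀ t, FT η t = ((FT η t).re : ℂ) := by
    intro t
    symm
    rw [← Complex.conj_eq_iff_re, FT, ← integral_conj, ← integral_neg_eq_self]
    congr 1
    funext x
    simp [η, f.neg, ← Complex.exp_conj, map_ofNat]
  have h0 : FT η 0 = ((∫ x, f x : ℝ) : ℂ) := by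
    rw [FT, ← integral_complex_ofReal]
    simp [η]
  refine ⟨convolution η η (ContinuousLinearMap.mul ℂ ℂ) volume, fun t => (FT η t).re ^ 2,
    ?_, ?_, ?_, fun t => sq_nonneg _, ?_, ?_⟩
  · exact hηc.contDiff_convolution_left (ContinuousLinearMap.mul ℝ ℂ) hηs hηi.locallyIntegrable
  · exact hηc.convolution _ hηc
  · have : Continuous (FT η) := by
      rw [FT_eq_fourier]
      exact (FourierTransform.fourier (hηc.toSchwartzMap hηs)).continuous
    fun_prop
  · have : (0 : ℝ) < ∫ x, f x := f.integral_pos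
    simp only [h0, Complex.ofReal_re]
    positivity
  · intro t
    rw [FT_eq_fourier, Real.fourier_mul_convolution_eq hηi hηi,
      ← FT_eq_fourier, Complex.ofReal_pow, ← hreal t, sq]

/-- Coefficient sums against dilates `φ (s x)`, `s ≥ 1`, of a test function are uniformly
bounded. -/
lemma LocSummable.exists_norm_tsum_le {a : ℝ → ℂ} (ha : LocSummable a) {φ : ℝ → ℂ}
    (hφ : Continuous φ) (hc : HasCompactSupport φ) :
    ∃ K, ∀ s : ℝ, 1 ≤ s → ‖∑' x : ℝ, a x * φ (s * x)‖ ≤ K := by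
  obtain ⟨B, hB⟩ := hc.exists_bound_of_continuous hφ
  obtain ⟨R, hR, hRs⟩ := hc.isCompact.isBounded.exists_pos_norm_le
  refine ⟨_, fun s hs => tsum_of_norm_bounded ((ha.2 R hR).mul_right B).hasSum fun x => ?_⟩
  by_cases hx : x ∈ Icc (-R) R
  · rw [indicator_of_mem hx, norm_mul]
    gcongr
    exact hB _
  · have h0 : φ (s * x) = 0 := by
      by_contra hne
      have h1 := hRs _ (subset_tsupport φ hne)
      rw [Real.norm_eq_abs, abs_mul, abs_of_pos (by linarith)] at h1
      exact hx (abs_le.1 (by nlinarith [abs_nonneg x]))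
    simp [h0, indicator_of_notMem hx]

/-- Dyadic comparison: every `t` lies in `[-r 2 ^ k, r 2 ^ k]` for some `k` with `4 ^ k`
comparable to `1 + t ^ 2`. -/
lemma exists_dyadic {r : ℝ} (hr : 0 < r) (hr1 : r ≤ 1) (t : ℝ) :
    ∃ k : ℕ, |t / 2 ^ k| < r ∧ (4 : ℝ) ^ k ≤ 8 / r ^ 2 * (1 + t ^ 2) := by
  obtain ⟨n, hn1, hn2⟩ := exists_nat_pow_near (x := 1 + |t| / r) (y := 2)
    (by have := div_nonneg (abs_nonneg t) hr.le; linarith) one_lt_two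
  refine ⟨n + 1, ?_, ?_⟩
  · rw [abs_div, abs_of_pos (by positivity : (0 : ℝ) < 2 ^ (n + 1)), div_lt_iff₀ (by positivity),
      mul_comm, ← div_lt_iff₀ hr]
    linarith
  · have h4 : (4 : ℝ) ^ (n + 1) = 4 * (2 ^ n) ^ 2 := by
      rw [pow_succ, ← pow_mul, mul_comm n 2, pow_mul]
      norm_num
      ring
    have h1 : ((2 : ℝ) ^ n) ^ 2 ≤ (1 + |t| / r) ^ 2 := by gcongr
    have h2 : (1 + |t| / r) ^ 2 ≤ 2 * (1 + t ^ 2 / r ^ 2) := by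
      rw [← sq_abs t, ← div_pow]
      nlinarith [sq_nonneg (1 - |t| / r)]
    have h3 : 2 * (1 + t ^ 2 / r ^ 2) ≤ 2 * ((1 + t ^ 2) / r ^ 2) := by
      rw [add_div]
      gcongr
      rw [le_div_iff₀ (by positivity)]
      nlinarith
    rw [h4]
    calc _ ≤ 4 * (2 * ((1 + t ^ 2) / r ^ 2)) := by linarith
      _ = _ := by ring

/-- A nonnegative FS-pair satisfies `∫ dμ(t) / (1 + t ^ 2) < ∞`. -/
lemma IsFSPair.integrable_inv_one_add_sq {μ : CMeasure} {a : ℝ → ℂ} (hFS : IsFSPair μ a)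
    (hpos : μ.Nonneg) : Integrable (fun t : ℝ => (1 + t ^ 2)⁻¹) μ.ν := by
  obtain ⟨φ, g, hφ, hc, hg, hg0, hgpos, hFT⟩ := exists_testFunction_FT_nonneg
  obtain ⟨hμ, ha, hsum⟩ := hFS
  obtain ⟨K, hK⟩ := ha.exists_norm_tsum_le hφ.continuous hc
  have hscale : ∀ k : ℕ, ∀ t : ℝ,
      FT (fun x => φ (2 ^ k * x)) t = (((2 ^ k)⁻¹ * g (t / 2 ^ k) : ℝ) : ℂ) := by
    intro k t
    have h := FT_comp_mul_left φ (s := 2 ^ k) (by positivity) t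
    rw [h, hFT]
    push_cast
    rfl
  have hbound : ∀ k : ℕ,
      ∫⁻ t, ENNReal.ofReal ((2 ^ k)⁻¹ * g (t / 2 ^ k)) ∂μ.ν ≤ ENNReal.ofReal K := by
    intro k
    have h2 : (1 : ℝ) ≤ 2 ^ k := one_le_pow₀ one_le_two
    have hs : ContDiff ℝ (⊤ : ℕ∞) fun x => φ (2 ^ k * x) := by fun_prop
    have hcs : HasCompactSupport fun x => φ (2 ^ k * x) :=
      hc.comp_homeomorph (Homeomorph.mulLeft₀ (2 ^ k : ℝ) (by positivity))
    have hi := hμ.integrable_FT hs hcs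
    rw [funext (hscale k)] at hi
    have hi' : Integrable (fun t => (2 ^ k)⁻¹ * g (t / 2 ^ k)) μ.ν := hi.re
    rw [← ofReal_integral_eq_lintegral_ofReal hi'
      (Eventually.of_forall fun t => mul_nonneg (by positivity) (hg0 _))]
    refine ENNReal.ofReal_le_ofReal ?_
    have he := hsum _ hs hcs
    have hint : μ.integral (FT fun x => φ (2 ^ k * x))
        = ((∫ t, (2 ^ k)⁻¹ * g (t / 2 ^ k) ∂μ.ν : ℝ) : ℂ) := by
      rw [← integral_complex_ofReal, CMeasure.integral]
      refine integral_congr_ae ?_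
      filter_upwards [hpos] with t ht
      rw [ht, hscale, mul_one]
    rw [hint] at he
    have h := hK (2 ^ k) h2
    rw [← he, Complex.norm_real] at h
    exact (le_abs_self _).trans h
  obtain ⟨r₀, hr₀, hball⟩ := Metric.eventually_nhds_iff.1
    (hg.continuousAt.eventually (lt_mem_nhds (half_lt_self hgpos)))
  set r := min r₀ 1
  have hr : 0 < r := lt_min hr₀ one_pos
  set M : ℝ := 8 / r ^ 2 * (2 / g 0)
  have hM : 0 ≤ M := by positivity
  have hpt : ∀ t : ℝ, ENNReal.ofReal ((1 + t ^ 2)⁻¹) ≤ ENNReal.ofReal M * ∑' k : ℕ,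
      ENNReal.ofReal ((1 / 2) ^ k) * ENNReal.ofReal ((2 ^ k)⁻¹ * g (t / 2 ^ k)) := by
    intro t
    obtain ⟨k, hk1, hk2⟩ := exists_dyadic hr (min_le_right _ _) t
    refine le_trans ?_ (mul_le_mul_right (ENNReal.le_tsum k) _)
    rw [← ENNReal.ofReal_mul (by positivity), ← ENNReal.ofReal_mul hM]
    refine ENNReal.ofReal_le_ofReal ?_
    have hgt : g 0 / 2 < g (t / 2 ^ k) := hball (by
      rw [Real.dist_eq, sub_zero]
      exact hk1.trans_le (min_le_left _ _))
    have h4 : (1 / 2 : ℝ) ^ k * ((2 ^ k)⁻¹ * g (t / 2 ^ k)) = g (t / 2 ^ k) / 4 ^ k := by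
      rw [show (4 : ℝ) = 2 * 2 by norm_num, mul_pow, one_div, inv_pow]
      field_simp
    rw [h4]
    calc (1 + t ^ 2)⁻¹ ≤ 8 / r ^ 2 / 4 ^ k := by
          rw [inv_le_iff_one_le_mul₀' (by positivity), mul_div_assoc', le_div_iff₀ (by positivity)]
          linarith
      _ = M * (g 0 / 2 / 4 ^ k) := by simp only [M]; field_simp
      _ ≤ M * (g (t / 2 ^ k) / 4 ^ k) := by gcongr
  refine ⟨(Continuous.inv₀ (by fun_prop) fun t => by positivity).aestronglyMeasurable, ?_⟩
  rw [hasFiniteIntegral_iff_ofReal (Eventually.of_forall fun t => by positivity)]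
  have hmeas : ∀ k : ℕ, Measurable fun t => ENNReal.ofReal ((2 ^ k)⁻¹ * g (t / 2 ^ k)) :=
    fun k => by fun_prop
  have hgeom : ∑' k : ℕ, ENNReal.ofReal ((1 / 2) ^ k) = ENNReal.ofReal 2 := by
    rw [← ENNReal.ofReal_tsum_of_nonneg (fun k => by positivity) summable_geometric_two,
      tsum_geometric_two]
  calc ∫⁻ t, ENNReal.ofReal ((1 + t ^ 2)⁻¹) ∂μ.ν
      ≤ ∫⁻ t, ENNReal.ofReal M * ∑' k : ℕ,
        ENNReal.ofReal ((1 / 2) ^ k) * ENNReal.ofReal ((2 ^ k)⁻¹ * g (t / 2 ^ k)) ∂μ.ν :=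
        lintegral_mono hpt
    _ = ENNReal.ofReal M * ∑' k : ℕ, ENNReal.ofReal ((1 / 2) ^ k) *
        ∫⁻ t, ENNReal.ofReal ((2 ^ k)⁻¹ * g (t / 2 ^ k)) ∂μ.ν := by
        rw [lintegral_const_mul' _ _ ENNReal.ofReal_ne_top,
          lintegral_tsum fun k => ((hmeas k).const_mul _).aemeasurable]
        simp_rw [lintegral_const_mul' _ _ ENNReal.ofReal_ne_top]
    _ ≤ ENNReal.ofReal M * ∑' k : ℕ, ENNReal.ofReal ((1 / 2) ^ k) * ENNReal.ofReal K := by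
        gcongr
        exact hbound _
    _ < ⊤ := by
        rw [ENNReal.tsum_mul_right, hgeom]
        finiteness

/-- Remark 2.4: a nonnegative FS-pair with exponentially growing coefficients has degree ≤ 2. -/
theorem stmt7 (μ : CMeasure) (a : ℝ → ℂ)
    (hFS : IsFSPair μ a) (hpos : μ.Nonneg) (hgrow : ExpGrowth a) :
    (∃ C > (0:ℝ), Integrable (fun t : ℝ => 1 / (C ^ 2 + t ^ 2)) μ.ν) ∧ μ.DegLE 2 := by
  have h := hFS.integrable_inv_one_add_sq hpos
  refine ⟨⟨1, one_pos, by simpa using h⟩, ?_⟩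
  have he : (-((2 : ℕ) : ℝ) / 2) = -1 := by norm_num
  simpa only [CMeasure.DegLE, he, Real.rpow_neg_one] using h
end
end
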